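/- arXiv:1601.01508 — 4 statements merged into one kernel-verified Lean document; each statement's English description precedes it below -/
import Mathlib

section
/- Let k be a field of characteristic zero, let f_1,…,f_m ∈ k[x_1,…,x_n] be polynomials with 1 ≤ m ≤ n, and let g ∈ k[x_1,…,x_n] be an irreducible polynomial. Then the following conditions are equivalent: (i) g divides dgcd(f_1,…,f_m); (ii) g² divides w(f_1,…,f_m) for some irreducible polynomial w ∈ k[x_1,…,x_m]; (iii) g² divides w(f_1,…,f_m) for some square-free polynomial w ∈ k[x_1,…,x_m]. -/
open MvPolynomial

/-- The Jacobian determinant of `f₁, …, f_m` with respect to the variables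
`x_{i 1}, …, x_{i m}`. -/
noncomputable def jacDet {k : Type*} [Field k] {m n : ℕ}
    (f : Fin m → MvPolynomial (Fin n) k) (i : Fin m → Fin n) : MvPolynomial (Fin n) k :=
  Matrix.det (Matrix.of fun j l => pderiv (i l) (f j))

/-- `d` is a greatest common divisor (in the UFD `k[x₁,…,xₙ]`) of all Jacobian
determinants `jac^{f₁,…,f_m}_{x_{i₁},…,x_{i_m}}`, `1 ≤ i₁ < … < i_m ≤ n`;
strictly increasing sequences `i₁ < … < i_m` are encoded as strictly monotone
maps `Fin m → Fin n`.  (Note that this forces `d = 0` when all the Jacobian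
determinants vanish.) -/
def IsDgcd {k : Type*} [Field k] {m n : ℕ}
    (f : Fin m → MvPolynomial (Fin n) k) (d : MvPolynomial (Fin n) k) : Prop :=
  (∀ i : Fin m → Fin n, StrictMono i → d ∣ jacDet f i) ∧
  ∀ e : MvPolynomial (Fin n) k, (∀ i : Fin m → Fin n, StrictMono i → e ∣ jacDet f i) → e ∣ d


theorem aux_elim {R : Type*} [CommRing R] [IsDomain R] [UniqueFactorizationMonoid R]
    (I : Ideal (Polynomial R)) [hI : I.IsPrime] (hn : ∀ w, I ≠ Ideal.span {w}) :
    ∃ r : R, Prime r ∧ Polynomial.C r ∈ I := by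
  classical
  let _ : NormalizedGCDMonoid R := Classical.choice inferInstance
  suffices h : ∃ r : R, r ≠ 0 ∧ Polynomial.C r ∈ I by
    obtain ⟨r, hr, hrI⟩ := h
    have hp : (I.comap (Polynomial.C : R →+* Polynomial R)).IsPrime := inferInstance
    obtain ⟨x, hx, hx'⟩ := Ideal.IsPrime.exists_mem_prime_of_ne_bot hp
      (fun h => hr (by
        have : r ∈ I.comap (Polynomial.C : R →+* Polynomial R) := hrI
        rw [h] at this; simpa using this))
    exact ⟨x, hx', hx⟩
  have h0 : I ≠ ⊥ := fun h => hn 0 (by simp [h])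
  obtain ⟨Q, hQ, hQp⟩ := Ideal.IsPrime.exists_mem_prime_of_ne_bot hI h0
  by_contra! hc
  apply hn Q
  apply le_antisymm _ (by simpa [Ideal.span_le] using hQ)
  intro F hF
  rw [Ideal.mem_span_singleton]
  have hdeg : Q.natDegree ≠ 0 := by
    intro h
    rw [Polynomial.natDegree_eq_zero] at h
    obtain ⟨r, rfl⟩ := h
    exact hc r (by rintro rfl; simp at hQp) hQ
  have hprim : Q.IsPrimitive := hQp.irreducible.isPrimitive hdeg
  by_contra hnd
  let K := FractionRing R
  have hirr := (hprim.irreducible_iff_irreducible_map_fraction_map (K := K)).1 hQp.irreducible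
  have hnd' : ¬ Q.map (algebraMap R K) ∣ F.map (algebraMap R K) :=
    fun h => hnd (hprim.dvd_of_fraction_map_dvd_fraction_map h)
  obtain ⟨a, b, hab⟩ := (hirr.coprime_iff_not_dvd.2 hnd')
  obtain ⟨s, hs0, hs⟩ := IsLocalization.integerNormalization_spec (nonZeroDivisors R) a
  obtain ⟨t, ht0, ht⟩ := IsLocalization.integerNormalization_spec (nonZeroDivisors R) b
  set a' := IsLocalization.integerNormalization (nonZeroDivisors R) a
  set b' := IsLocalization.integerNormalization (nonZeroDivisors R) b
  have key : Polynomial.C (s * t : R) = Polynomial.C (t : R) * a' * Q + Polynomial.C (s:R) * b' * F := by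
    apply Polynomial.map_injective (algebraMap R K) (IsFractionRing.injective R K)
    simp only [Polynomial.map_add, Polynomial.map_mul, hs, ht, Polynomial.map_C, map_mul]
    rw [Algebra.smul_def, Algebra.smul_def]
    simp only [Polynomial.algebraMap_apply]
    linear_combination (-Polynomial.C (algebraMap R K s) * Polynomial.C (algebraMap R K t)) * hab
  refine hc (s * t) (mul_ne_zero (nonZeroDivisors.ne_zero hs0) (nonZeroDivisors.ne_zero ht0)) ?_
  rw [key]
  exact I.add_mem (I.mul_mem_left _ hQ) (I.mul_mem_left _ hF)

theorem aux_irred {R : Type*} [CommRing R] [IsDomain R] [UniqueFactorizationMonoid R]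
    (hR : ∀ a b : R, Prime a → b ≠ 0 → ∃ q, Prime q ∧ ¬ q ∣ a * b)
    (I : Ideal (Polynomial R)) [hI : I.IsPrime] (hn : ∀ w, I ≠ Ideal.span {w}) :
    ∃ w ∈ I ^ 2, Irreducible w := by
  obtain ⟨P, hP, hPI⟩ := aux_elim I hn
  obtain ⟨Q, hQ, hPQ, hQ0⟩ : ∃ Q ∈ I, ¬ Polynomial.C P ∣ Q ∧ Q.coeff 0 ≠ 0 := by
    have : ∃ Q ∈ I, ¬ Polynomial.C P ∣ Q := by
      by_contra! h
      exact hn _ (le_antisymm (fun F hF => Ideal.mem_span_singleton.2 (h F hF))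
        (by simpa [Ideal.span_le] using hPI))
    obtain ⟨Q, hQ, hPQ⟩ := this
    by_cases h0 : Q.coeff 0 = 0
    · refine ⟨Q + Polynomial.C P, I.add_mem hQ hPI, ?_, ?_⟩
      · rwa [dvd_add_left dvd_rfl]
      · simpa [h0] using hP.ne_zero
    · exact ⟨Q, hQ, hPQ, h0⟩
  obtain ⟨q, hq, hqn⟩ := hR P (Q.coeff 0) hP hQ0
  have hqP : ¬ q ∣ P := fun h => hqn (h.mul_right _)
  have hqQ : ¬ q ∣ Q.coeff 0 := fun h => hqn (h.mul_left _)
  set N := (Q^2).natDegree + 1 with hN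
  set w : Polynomial R := Polynomial.C q * Q ^ 2 + Polynomial.C (P ^ 2) * Polynomial.X ^ N with hw
  have hcN : w.coeff N = P ^ 2 := by
    rw [hw, Polynomial.coeff_add, Polynomial.coeff_C_mul, Polynomial.coeff_C_mul,
      Polynomial.coeff_X_pow_self,
      Polynomial.coeff_eq_zero_of_natDegree_lt (Nat.lt_succ_self (Q^2).natDegree)]
    ring
  have hclt : ∀ i, i ≠ N → w.coeff i = q * (Q^2).coeff i := by
    intro i hi
    rw [hw, Polynomial.coeff_add, Polynomial.coeff_C_mul, Polynomial.coeff_C_mul,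
      Polynomial.coeff_X_pow, if_neg hi]
    ring
  have hnd : w.natDegree = N := by
    apply Polynomial.natDegree_eq_of_le_of_coeff_ne_zero
    · rw [Polynomial.natDegree_le_iff_coeff_eq_zero]
      intro i hi
      rw [hclt i (by omega), Polynomial.coeff_eq_zero_of_natDegree_lt (by omega), mul_zero]
    · rw [hcN]; exact pow_ne_zero _ hP.ne_zero
  have hlc : w.leadingCoeff = P ^ 2 := by rw [Polynomial.leadingCoeff, hnd, hcN]
  have hw0 : w ≠ 0 := by
    intro h; rw [h] at hlc; exact pow_ne_zero 2 hP.ne_zero (by simpa using hlc.symm)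
  refine ⟨w, ?_, ?_⟩
  · refine Ideal.add_mem _ (Ideal.mul_mem_left _ _ (Ideal.pow_mem_pow hQ 2)) (Ideal.mul_mem_right _ _ ?_)
    rw [map_pow]; exact Ideal.pow_mem_pow hPI 2
  · have hqi : (Ideal.span {q}).IsPrime := (Ideal.span_singleton_prime hq.ne_zero).2 hq
    refine Polynomial.irreducible_of_eisenstein_criterion hqi ?_ ?_ ?_ ?_ ?_
    · rw [hlc, Ideal.mem_span_singleton]
      exact fun h => hqP (hq.dvd_of_dvd_pow h)
    · intro i hi
      rw [Polynomial.degree_eq_natDegree hw0, hnd] at hi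
      have : i < N := by exact_mod_cast hi
      rw [hclt i this.ne, Ideal.mem_span_singleton]
      exact dvd_mul_right _ _
    · rw [← Polynomial.natDegree_pos_iff_degree_pos, hnd]; omega
    · rw [hclt 0 (by omega), Ideal.span_singleton_pow, Ideal.mem_span_singleton, pow_two,
        mul_dvd_mul_iff_left hq.ne_zero, pow_two, Polynomial.mul_coeff_zero]
      exact fun h => hqQ ((hq.dvd_or_dvd h).elim id id)
    · intro r hr
      have h1 : r ∣ P ^ 2 := by rw [← hcN]; exact (Polynomial.C_dvd_iff_dvd_coeff _ _).1 hr N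
      obtain ⟨i, hi, ha⟩ := (dvd_prime_pow hP 2).1 h1
      rcases Nat.eq_zero_or_pos i with rfl | hpos
      · rw [pow_zero] at ha; exact ha.symm.isUnit isUnit_one
      exfalso
      have h2 : P ∣ r := (dvd_pow_self P hpos.ne').trans ha.symm.dvd
      have h3 : Polynomial.C P ∣ w := (map_dvd Polynomial.C h2).trans hr
      have hCP : Prime (Polynomial.C P) := Polynomial.prime_C_iff.2 hP
      rw [hw, dvd_add_left (by rw [map_pow]; exact (dvd_pow_self _ two_ne_zero).mul_right _)] at h3
      rcases hCP.dvd_or_dvd h3 with h | h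
      · rw [Polynomial.C_dvd_iff_dvd_coeff] at h
        have := h 0
        rw [Polynomial.coeff_C_zero] at this
        exact hqP ((hP.dvd_prime_iff_associated hq).1 this).symm.dvd
      · exact hPQ (hCP.dvd_of_dvd_pow h)

theorem aux_prime {σ k : Type*} [Field k] (a b : MvPolynomial σ k) (ha : Prime a) (hb : b ≠ 0) :
    ∃ q, Prime q ∧ ¬ q ∣ a * b := by
  have h1 : ¬ IsUnit (1 + a * b) := by
    intro h
    rw [MvPolynomial.isUnit_iff_eq_C_of_isReduced] at h
    obtain ⟨c, hc, h⟩ := h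
    have h2 : a * b = C (c - 1) := by rw [map_sub, ← h]; simp
    by_cases hc1 : c = 1
    · rw [hc1] at h2
      simp [ha.ne_zero, hb] at h2
    · apply ha.not_isUnit
      apply isUnit_of_mul_isUnit_left (y := b)
      rw [h2]
      exact (IsUnit.mk0 _ (sub_ne_zero.2 hc1)).map C
  have h0 : 1 + a * b ≠ 0 := by
    intro h
    apply ha.not_isUnit
    apply isUnit_of_mul_isUnit_left (y := b)
    rw [← neg_eq_of_add_eq_zero_right h]
    exact isUnit_one.neg
  obtain ⟨q, hq, hd⟩ := WfDvdMonoid.exists_irreducible_factor h1 h0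
  refine ⟨q, hq.prime, fun h => hq.not_isUnit (isUnit_of_dvd_one ((dvd_add_left h).1 hd))⟩

noncomputable def auxE {σ k : Type*} [DecidableEq σ] [Field k] (t : σ) :
    MvPolynomial σ k ≃ₐ[k] Polynomial (MvPolynomial {x : σ // x ≠ t} k) :=
  (renameEquiv k (Equiv.optionSubtypeNe t).symm).trans (optionEquivLeft k _)

theorem auxE_symm_C {σ k : Type*} [DecidableEq σ] [Field k] (t : σ) (r : MvPolynomial {x : σ // x ≠ t} k) :
    (auxE t).symm (Polynomial.C r) = rename Subtype.val r := by
  rw [AlgEquiv.symm_apply_eq]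
  have : (Polynomial.CAlgHom : MvPolynomial {x : σ // x ≠ t} k →ₐ[MvPolynomial {x : σ // x ≠ t} k] _).restrictScalars k = (auxE t).toAlgHom.comp (rename Subtype.val) := by
    apply MvPolynomial.algHom_ext
    intro i
    simp [auxE, i.2]
  exact DFunLike.congr_fun this r

theorem aux_np {A B : Type*} [CommRing A] [CommRing B] (e : A ≃+* B) (I : Ideal A) 
    (hn : ∀ w, I ≠ Ideal.span {w}) (w : B) : I.comap e.symm.toRingHom ≠ Ideal.span {w} := by
  intro h
  apply hn (e.symm w)
  ext x
  have : e x ∈ I.comap e.symm.toRingHom ↔ e x ∈ Ideal.span {w} := by rw [h]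
  rw [Ideal.mem_span_singleton] at this ⊢
  simp only [RingEquiv.toRingHom_eq_coe, Ideal.mem_comap, RingHom.coe_coe, RingEquiv.symm_apply_apply] at this
  rw [this]
  constructor
  · intro h; simpa using map_dvd e.symm h
  · intro h; simpa using map_dvd e h

theorem aux_elim' {σ k : Type*} [Finite σ] [Field k] (I : Ideal (MvPolynomial σ k)) [hI : I.IsPrime]
    (hn : ∀ w, I ≠ Ideal.span {w}) (t : σ) :
    ∃ r : MvPolynomial {x : σ // x ≠ t} k, r ≠ 0 ∧ rename Subtype.val r ∈ I := by
  classical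
  let e := (auxE (k := k) t).toRingEquiv
  obtain ⟨r, hr, h⟩ := aux_elim (I.comap e.symm.toRingHom) (aux_np e I hn)
  refine ⟨r, hr.ne_zero, ?_⟩
  rw [← auxE_symm_C]; exact h

theorem aux_irred' {σ k : Type*} [Finite σ] [Field k] (I : Ideal (MvPolynomial σ k)) [hI : I.IsPrime]
    (hn : ∀ w, I ≠ Ideal.span {w}) (t : σ) :
    ∃ w ∈ I ^ 2, Irreducible w := by
  classical
  let e := (auxE (k := k) t).toRingEquiv
  obtain ⟨w, hw, h⟩ := aux_irred aux_prime (I.comap e.symm.toRingHom) (aux_np e I hn)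
  refine ⟨e.symm w, ?_, ?_⟩
  · have := Ideal.le_comap_pow e.symm.toRingHom (K := I) 2 hw
    exact this
  · exact (MulEquiv.irreducible_iff e.symm).2 h

theorem aux_fs (K L : Type*) [Field K] [Field L] [Algebra K L] [CharZero K] :
    Algebra.FormallySmooth K L := by
  obtain ⟨s, hs⟩ := exists_isTranscendenceBasis K L
  have := hs.isAlgebraic_field
  have : Algebra.IsSeparable (IntermediateField.adjoin K (Set.range ((↑) : s → L))) L := by
    infer_instance
  exact .of_algebraicIndependent_of_isSeparable hs.1

/-- first-order deformation of a point -/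
noncomputable def auxPsi {σ k L : Type*} [Field k] [Field L] [Algebra k L]
    (a v : σ → L) : MvPolynomial σ k →ₐ[k] TrivSqZeroExt L L :=
  aeval fun j => TrivSqZeroExt.inl (a j) + TrivSqZeroExt.inr (v j)

theorem auxPsi_fst {σ k L : Type*} [Field k] [Field L] [Algebra k L]
    (a v : σ → L) (w : MvPolynomial σ k) : (auxPsi a v w).fst = aeval a w := by
  have : (TrivSqZeroExt.fstHom k L L).comp (auxPsi a v) = aeval a := by
    apply MvPolynomial.algHom_ext
    intro i; simp [auxPsi]
  exact DFunLike.congr_fun this w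

theorem auxPsi_snd {σ k L : Type*} [Fintype σ] [Field k] [Field L] [Algebra k L]
    (a v : σ → L) (w : MvPolynomial σ k) :
    (auxPsi a v w).snd = ∑ j, v j * aeval a (pderiv j w) := by
  classical
  induction w using MvPolynomial.induction_on with
  | C c => 
    have : auxPsi a v (C c) = algebraMap k (TrivSqZeroExt L L) c := by
      simp [auxPsi]
    rw [this]; simp [TrivSqZeroExt.algebraMap_eq_inl']
  | add p q hp hq => simp [hp, hq, mul_add, Finset.sum_add_distrib]
  | mul_X p i hp =>
    have hx : auxPsi (k := k) a v (X i) = TrivSqZeroExt.inl (a i) + TrivSqZeroExt.inr (v i) := by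
      simp [auxPsi]
    rw [map_mul, TrivSqZeroExt.snd_mul, hp, auxPsi_fst, hx]
    simp [Pi.single_apply, mul_add, Finset.sum_add_distrib, apply_ite (aeval a)]
    rw [mul_comm, Finset.sum_mul]
    congr 1
    exact Finset.sum_congr rfl fun x _ => by ring

theorem aux_sq {L : Type*} [Field L] (I : Ideal (TrivSqZeroExt L L))
    (h : ∀ x ∈ I, x.fst = 0) : I ^ 2 = 0 := by
  rw [pow_two, Ideal.zero_eq_bot, eq_bot_iff, Ideal.mul_le]
  intro r hr s hs
  rw [Ideal.mem_bot]
  apply TrivSqZeroExt.ext <;> simp [h r hr, h s hs]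

theorem aux_mkD {k L : Type*} [Field k] [Field L] [Algebra k L] (G : L →+* TrivSqZeroExt L L)
    (hG : ∀ x, (G x).fst = x) 
    (h1 : ∀ c, G (algebraMap k L c) = algebraMap k (TrivSqZeroExt L L) c) :
    ∃ D : Derivation k L L, ∀ x, D x = (G x).snd := by
  refine ⟨Derivation.mk' 
    { toFun := fun x => (G x).snd
      map_add' := by intro x y; simp
      map_smul' := by
        intro c x
        simp only [Algebra.smul_def, map_mul, RingHom.id_apply]
        rw [h1, TrivSqZeroExt.algebraMap_eq_inl']
        simp } ?_, fun x => rfl⟩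
  intro x y
  simp [TrivSqZeroExt.snd_mul, hG]
  exact mul_comm _ _

theorem aux_deriv {σ k L : Type*} [Fintype σ] [Field k] [CharZero k] [Field L] [Algebra k L]
    (a v : σ → L) (h : ∀ w : MvPolynomial σ k, aeval a w = 0 → ∑ j, v j * aeval a (pderiv j w) = 0) :
    ∃ D : Derivation k L L, ∀ j, D (a j) = v j := by
  let p := RingHom.ker (aeval a : MvPolynomial σ k →ₐ[k] L)
  have hp : p.IsPrime := RingHom.ker_isPrime _
  let A := MvPolynomial σ k ⧸ p
  let φ : A →ₐ[k] L := Ideal.Quotient.liftₐ p (aeval a) (fun w hw => hw)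
  have hφ : Function.Injective φ := RingHom.kerLift_injective _
  let ψ : A →ₐ[k] TrivSqZeroExt L L := Ideal.Quotient.liftₐ p (auxPsi a v) (fun w hw => by
    apply TrivSqZeroExt.ext
    · rw [auxPsi_fst]; exact hw
    · rw [auxPsi_snd]; exact h w hw)
  have hfst : ∀ x, (ψ x).fst = φ x := by
    intro x
    obtain ⟨w, rfl⟩ := Ideal.Quotient.mk_surjective x
    exact auxPsi_fst a v w
  let K := FractionRing A
  let ι : K →+* L := IsFractionRing.lift (A := A) (K := K) (g := φ.toRingHom) hφ
  have hu : ∀ y : nonZeroDivisors A, IsUnit (ψ.toRingHom y) := by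
    intro y
    rw [TrivSqZeroExt.isUnit_iff_isUnit_fst]
    change IsUnit (ψ (y:A)).fst
    rw [hfst, isUnit_iff_ne_zero]
    exact (map_ne_zero_iff φ hφ).2 (nonZeroDivisors.coe_ne_zero y)
  let κ : K →+* TrivSqZeroExt L L := IsLocalization.lift (M := nonZeroDivisors A) (S := K) hu
  have hκ : ∀ x : A, κ (algebraMap A K x) = ψ x := fun x => IsLocalization.lift_eq hu x
  have hι : ∀ x : A, ι (algebraMap A K x) = φ x := fun x => IsLocalization.lift_eq _ x
  have hcomp : (TrivSqZeroExt.fstHom L L L).toRingHom.comp κ = ι := by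
    apply IsLocalization.ringHom_ext (nonZeroDivisors A)
    refine RingHom.ext fun x => ?_
    rw [RingHom.comp_apply, RingHom.comp_apply, RingHom.comp_apply, hκ, hι]
    exact hfst x
  let _ := ι.toAlgebra
  let _ := κ.toAlgebra
  have : CharZero K := charZero_of_injective_algebraMap (R := k) (algebraMap k K).injective
  have := aux_fs K L
  let F : TrivSqZeroExt L L →ₐ[K] L := 
    { (TrivSqZeroExt.fstHom L L L).toRingHom with 
      commutes' := fun x => DFunLike.congr_fun hcomp x }
  have hF : ∀ x, F x = x.fst := fun x => rfl
  have hFs : Function.Surjective F := fun x => ⟨TrivSqZeroExt.inl x, by simp [hF]⟩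
  have hnil : IsNilpotent (RingHom.ker F) := by
    exact ⟨2, aux_sq _ fun x hx => hx⟩
  let G := Algebra.FormallySmooth.liftOfSurjective (AlgHom.id K L) F hFs hnil
  have hG : ∀ x, (G x).fst = x := fun x => 
    Algebra.FormallySmooth.liftOfSurjective_apply (AlgHom.id K L) F hFs hnil x
  have hGk : ∀ x : A, G (φ x) = ψ x := by
    intro x
    rw [← hι x, ← hκ x]
    exact G.commutes (algebraMap A K x)
  obtain ⟨D, hD⟩ := aux_mkD (k := k) (G : L →+* TrivSqZeroExt L L) hG (fun c => by
    rw [← φ.commutes, ← ψ.commutes]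
    exact hGk _)
  refine ⟨D, ?_⟩
  · intro j
    have h1 : φ (Ideal.Quotient.mk p (X j)) = a j := by
      change aeval a (X j) = a j
      simp
    have h2 : ψ (Ideal.Quotient.mk p (X j)) = TrivSqZeroExt.inl (a j) + TrivSqZeroExt.inr (v j) := by
      change auxPsi a v (X j) = _
      simp [auxPsi]
    rw [hD]
    change (G (a j)).snd = v j
    rw [← h1, hGk, h2]; simp

theorem aux_rank {L : Type*} [Field L] {m n : ℕ} (M : Matrix (Fin m) (Fin n) L)
    (h : ∀ i : Fin m → Fin n, StrictMono i → (M.submatrix id i).det = 0) :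
    ∃ c : Fin m → L, c ≠ 0 ∧ Matrix.vecMul c M = 0 := by
  by_contra! hc
  have hli : LinearIndependent L M.row := by
    rw [← Matrix.vecMul_injective_iff]
    refine (injective_iff_map_eq_zero (Matrix.vecMulLinear M)).2 ?_
    intro c h0
    by_contra hne
    exact hc c hne h0
  have hr := hli.rank_matrix
  rw [Matrix.rank_eq_finrank_span_cols, Fintype.card_fin] at hr
  obtain ⟨κ, a, ha, hs, hl⟩ := exists_linearIndependent' L M.col
  have : Fintype κ := Fintype.ofInjective a ha
  rw [← hs, finrank_span_eq_card hl] at hr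
  classical
  let s : Finset (Fin n) := Finset.univ.map ⟨a, ha⟩
  have hcard : s.card = m := by simp [s, hr]
  let i := s.orderEmbOfFin hcard
  have hi := h i i.strictMono
  have hmem : ∀ x, ∃ y : κ, a y = i x := by
    intro x
    have := s.orderEmbOfFin_mem hcard x
    obtain ⟨y, -, hy⟩ := Finset.mem_map.1 this
    exact ⟨y, hy⟩
  choose b hb using hmem
  have hbi : Function.Injective b := by
    intro x y hxy
    apply i.injective
    rw [← hb, ← hb, hxy]
  have hl2 : LinearIndependent L (M.submatrix id i).col := by
    have := hl.comp b hbi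
    convert! this using 1
    ext x y
    change M y (i x) = M y (a (b x))
    rw [hb]
  rw [Matrix.linearIndependent_cols_iff_isUnit, Matrix.isUnit_iff_isUnit_det] at hl2
  rw [hi] at hl2
  simp at hl2

theorem aux_chain {σ k B M : Type*} [Fintype σ] [Field k] [CommRing B] [Algebra k B]
    (a : σ → B) [AddCommGroup M] [Module B M] [Module k M] [IsScalarTower k B M]
    (D : Derivation k B M) (w : MvPolynomial σ k) :
    D (aeval a w) = ∑ j, aeval a (pderiv j w) • D (a j) := by
  classical
  induction w using MvPolynomial.induction_on with
  | C c => simp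
  | add p q hp hq => simp [hp, hq, add_smul, Finset.sum_add_distrib]
  | mul_X p i hp =>
    simp [Pi.single_apply, add_smul, Finset.sum_add_distrib, apply_ite (aeval a), hp, ite_smul,
      Finset.smul_sum, mul_smul]

theorem aux_const {σ k : Type*} [Field k] [CharZero k] (w : MvPolynomial σ k)
    (h : ∀ j, pderiv j w = 0) : w = C (coeff 0 w) := by
  classical
  ext m
  rw [coeff_C]
  split_ifs with hm
  · rw [hm]
  · obtain ⟨j, hj⟩ : ∃ j, m j ≠ 0 := by
      by_contra! h; exact hm (by ext; simp [h])
    have := congrArg (coeff (m - Finsupp.single j 1)) (h j)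
    rw [coeff_pderiv] at this
    have h2 : m - Finsupp.single j 1 + Finsupp.single j 1 = m := by
      apply tsub_add_cancel_of_le
      simp; omega
    rw [h2] at this
    simp only [coeff_zero, mul_eq_zero] at this
    rcases this with h | h
    · exact h
    · exfalso
      exact Nat.cast_add_one_ne_zero (R := k) _ (by simpa using h)

theorem aux_deg {σ k : Type*} [Field k] (w : MvPolynomial σ k)
    (j : σ) (h : pderiv j w ≠ 0) : (pderiv j w).totalDegree < w.totalDegree := by
  classical
  obtain ⟨m, hm, hd⟩ := Finset.exists_mem_eq_sup (pderiv j w).support (support_nonempty.2 h)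
    (fun s : σ →₀ ℕ => s.sum fun _ e => e)
  have h1 : (pderiv j w).totalDegree = m.sum fun _ e => e := hd
  have h2 : m + Finsupp.single j 1 ∈ w.support := by
    rw [mem_support_iff, coeff_pderiv] at hm
    rw [mem_support_iff]
    exact left_ne_zero_of_mul hm
  have h3 := le_totalDegree h2
  rw [Finsupp.sum_add_index' (by simp) (by simp)] at h3
  simp at h3
  omega

/-- a prime cannot divide all its partial derivatives -/
theorem aux_grad {σ k : Type*} [Field k] [CharZero k] (w : MvPolynomial σ k) (hw : Prime w) :
    ∃ j, ¬ w ∣ pderiv j w := by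
  by_contra! h
  have h1 : ∀ j, pderiv j w = 0 := by
    intro j
    by_contra hne
    have h2 := aux_deg w j hne
    have h3 := totalDegree_le_of_dvd_of_isDomain (h j) hne
    omega
  have h2 := aux_const w h1
  have h3 : coeff 0 w ≠ 0 := by
    intro h4; rw [h4] at h2; exact hw.ne_zero (by simpa using h2)
  apply hw.not_isUnit
  rw [h2]
  exact (IsUnit.mk0 _ h3).map C

/-- an element of minimal degree in the kernel has a nonvanishing gradient -/
theorem aux_min {σ k L : Type*} [Field k] [CharZero k] [Field L] [Algebra k L] (a : σ → L)
    (h : ∃ w : MvPolynomial σ k, w ≠ 0 ∧ aeval a w = 0) :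
    ∃ w : MvPolynomial σ k, w ≠ 0 ∧ aeval a w = 0 ∧ ∃ j, aeval a (pderiv j w) ≠ 0 := by
  classical
  have hex : ∃ N, ∃ w : MvPolynomial σ k, w ≠ 0 ∧ aeval a w = 0 ∧ w.totalDegree = N := by
    obtain ⟨w, h1, h2⟩ := h
    exact ⟨_, w, h1, h2, rfl⟩
  obtain ⟨w, h1, h2, h3⟩ := Nat.find_spec hex
  refine ⟨w, h1, h2, ?_⟩
  by_contra! hc
  have h4 : ∀ j, pderiv j w = 0 := by
    intro j
    by_contra hne
    have h5 := aux_deg w j hne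
    exact Nat.find_min hex (h3 ▸ h5) ⟨_, hne, hc j, rfl⟩
  have h5 := aux_const w h4
  rw [h5] at h2
  simp only [algHom_C, map_eq_zero] at h2
  rw [h2] at h5
  exact h1 (by simpa using h5)

/-- the common data: `L` is the function field of `g = 0` -/
theorem aux_hard {k L : Type*} [Field k] [CharZero k] [Field L] [Algebra k L] {m n : ℕ}
    (hm : 1 ≤ m) (f : Fin m → MvPolynomial (Fin n) k)
    (g : MvPolynomial (Fin n) k) (hg : Prime g)
    (ι : MvPolynomial (Fin n) k →ₐ[k] L) (hι : ∀ x, ι x = 0 ↔ g ∣ x)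
    (c : Fin m → L) (hc : c ≠ 0) (hcJ : ∀ l, ∑ j, c j * ι (pderiv l (f j)) = 0) :
    ∃ w : MvPolynomial (Fin m) k, Irreducible w ∧ g ^ 2 ∣ aeval f w := by
  classical
  let a : Fin m → L := fun j => ι (f j)
  have ha : ∀ w : MvPolynomial (Fin m) k, ι (aeval f w) = aeval a w := by
    intro w
    have : ι.comp (aeval f) = aeval a := by
      apply MvPolynomial.algHom_ext; intro i; simp [a]
    exact DFunLike.congr_fun this w
  let p := RingHom.ker (aeval a : MvPolynomial (Fin m) k →ₐ[k] L)
  have hp : p.IsPrime := RingHom.ker_isPrime _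
  have hpg : ∀ w, w ∈ p ↔ g ∣ aeval f w := by
    intro w
    rw [← hι, ha]; exact Iff.rfl
  by_cases hn : ∀ w, p ≠ Ideal.span {w}
  · obtain ⟨w, hw, hirr⟩ := aux_irred' p hn ⟨0, hm⟩
    refine ⟨w, hirr, ?_⟩
    have hle : p ≤ (Ideal.span {g}).comap (aeval f : MvPolynomial (Fin m) k →ₐ[k] _) := by
      intro w hw
      rw [Ideal.mem_comap, Ideal.mem_span_singleton]
      exact (hpg w).1 hw
    have h1 := Ideal.le_comap_pow _ 2 (Ideal.pow_right_mono hle 2 hw)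
    rw [Ideal.mem_comap, Ideal.span_singleton_pow, Ideal.mem_span_singleton] at h1
    exact h1
  push Not at hn
  obtain ⟨w, hw⟩ := hn
  have hwp : w ∈ p := by rw [hw]; exact Ideal.mem_span_singleton_self w
  have haw : aeval a w = 0 := hwp
  obtain ⟨A, hA⟩ := (hpg w).1 hwp
  let u : Fin m → L := fun j => aeval a (pderiv j w)
  -- orthogonality
  have horth : ∀ v : Fin m → L, ∑ j, v j * u j = 0 → ∑ j, c j * v j = 0 := by
    intro v hv
    obtain ⟨D, hD⟩ := aux_deriv (k := k) a v (by
      intro w' hw'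
      have : w' ∈ p := hw'
      rw [hw, Ideal.mem_span_singleton] at this
      obtain ⟨z, rfl⟩ := this
      have : ∀ j, v j * aeval a (pderiv j (w * z)) = (v j * u j) * aeval a z := by
        intro j
        rw [pderiv_mul, map_add, map_mul, map_mul, haw]; simp only [u]; ring
      simp only [this]
      rw [← Finset.sum_mul, hv, zero_mul])
    have hDf : ∀ j, v j = ∑ l, ι (pderiv l (f j)) * D (ι (X l)) := by
      intro j
      have h1 := aux_chain (k := k) (fun l => ι (X l)) D (f j)
      have h2 : ∀ F : MvPolynomial (Fin n) k, aeval (fun l => ι (X l)) F = ι F := by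
        intro F
        have : aeval (fun l => ι (X l)) = ι := by
          apply MvPolynomial.algHom_ext; intro i; simp
        rw [this]
      simp only [h2, smul_eq_mul] at h1
      rw [← h1, ← hD]
    simp_rw [hDf, Finset.mul_sum]
    rw [Finset.sum_comm]
    apply Finset.sum_eq_zero
    intro l _
    simp_rw [← mul_assoc]
    rw [← Finset.sum_mul, hcJ, zero_mul]
  -- `c` is a multiple of `u`
  obtain ⟨lam, hlam⟩ : ∃ lam : L, ∀ j, c j = lam * u j := by
    by_cases hu : ∀ j, u j = 0
    · exfalso
      apply hc
      funext j
      have := horth (Pi.single j 1) (by simp [hu])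
      simpa [Pi.single_apply] using this
    · push Not at hu
      obtain ⟨j0, hj0⟩ := hu
      refine ⟨c j0 / u j0, fun j => ?_⟩
      have := horth (u j0 • Pi.single j 1 - u j • Pi.single j0 1) (by
        simp [sub_mul, Finset.sum_sub_distrib, Pi.single_apply]; ring)
      simp [mul_sub, Finset.sum_sub_distrib, Pi.single_apply] at this
      field_simp
      linear_combination this
  have hlam0 : lam ≠ 0 := by
    rintro rfl
    exact hc (funext fun j => by simp [hlam])
  have hw0 : w ≠ 0 := by
    rintro rfl
    exact hc (funext fun j => by simp [hlam, u])
  have hwprime : Prime w := (Ideal.span_singleton_prime hw0).1 (hw ▸ hp)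
  refine ⟨w, hwprime.irreducible, ?_⟩
  obtain ⟨l, hl⟩ := aux_grad g hg
  have h1 : ∑ j, u j * ι (pderiv l (f j)) = ι A * ι (pderiv l g) := by
    have h2 := congrArg ι (aux_chain f (pderiv l) w)
    rw [hA, pderiv_mul, map_add, map_mul, map_mul, (hι g).2 dvd_rfl, zero_mul, add_zero,
      map_sum] at h2
    rw [mul_comm (ι A), h2]
    apply Finset.sum_congr rfl
    intro j _
    rw [smul_eq_mul, map_mul, ha]
  have h2 := hcJ l
  simp_rw [hlam, mul_assoc] at h2
  rw [← Finset.mul_sum, h1] at h2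
  have h3 : ι (pderiv l g) ≠ 0 := fun h => hl ((hι _).1 h)
  have h4 : ι A = 0 := by simpa [hlam0, h3] using h2
  rw [hA, pow_two]
  exact mul_dvd_mul_left g ((hι A).1 h4)

theorem aux_easy {k L : Type*} [Field k] [CharZero k] [Field L] [Algebra k L] {m n : ℕ}
    (f : Fin m → MvPolynomial (Fin n) k)
    (g : MvPolynomial (Fin n) k)
    (ι : MvPolynomial (Fin n) k →ₐ[k] L) (hι : ∀ x, ι x = 0 ↔ g ∣ x)
    (w : MvPolynomial (Fin m) k) (hw : Squarefree w) (hgw : g ^ 2 ∣ aeval f w) :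
    ∃ c : Fin m → L, c ≠ 0 ∧ ∀ l, ∑ j, c j * ι (pderiv l (f j)) = 0 := by
  classical
  let a : Fin m → L := fun j => ι (f j)
  have ha : ∀ w : MvPolynomial (Fin m) k, ι (aeval f w) = aeval a w := by
    intro w
    have : ι.comp (aeval f) = aeval a := by
      apply MvPolynomial.algHom_ext; intro i; simp [a]
    exact DFunLike.congr_fun this w
  let p := RingHom.ker (aeval a : MvPolynomial (Fin m) k →ₐ[k] L)
  have hp : p.IsPrime := RingHom.ker_isPrime _
  have hpg : ∀ w, w ∈ p ↔ g ∣ aeval f w := by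
    intro w
    rw [← hι, ha]; exact Iff.rfl
  have hgrad : ∀ (w : MvPolynomial (Fin m) k) (A : MvPolynomial (Fin n) k), aeval f w = g * A → ∀ l,
      ∑ j, aeval a (pderiv j w) * ι (pderiv l (f j)) = ι A * ι (pderiv l g) := by
    intro w A hA l
    have h2 := congrArg ι (aux_chain f (pderiv l) w)
    rw [hA, pderiv_mul, map_add, map_mul, map_mul, (hι g).2 dvd_rfl, zero_mul, add_zero,
      map_sum] at h2
    rw [mul_comm (ι A), h2]
    apply Finset.sum_congr rfl
    intro j _
    rw [smul_eq_mul, map_mul, ha]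
  have hwp : w ∈ p := (hpg w).2 ((dvd_pow_self g two_ne_zero).trans hgw)
  have hw0 : w ≠ 0 := hw.ne_zero
  by_cases hc : (fun j => aeval a (pderiv j w)) ≠ 0
  · refine ⟨_, hc, ?_⟩
    obtain ⟨A, hA⟩ := hgw
    intro l
    rw [hgrad w (g * A) (by rw [hA]; ring) l, map_mul, (hι g).2 dvd_rfl]
    ring
  push Not at hc
  have hc' : ∀ j, pderiv j w ∈ p := fun j => congrFun hc j
  by_cases hn : ∀ v, p ≠ Ideal.span {v}
  · obtain ⟨Q, hQ0, hQ, t, ht⟩ := aux_min (k := k) a ⟨w, hw0, hwp⟩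
    obtain ⟨P0, hP00, hP0⟩ := aux_elim' p hn t
    have hre : ∀ z : MvPolynomial {x // x ≠ t} k,
        aeval a (rename Subtype.val z) = aeval (fun x : {x // x ≠ t} => a x) z := by
      intro z; rw [aeval_rename]; rfl
    obtain ⟨P, hP', hP, s, hs⟩ := aux_min (k := k) (fun x : {x // x ≠ t} => a x)
      ⟨P0, hP00, by rw [← hre]; exact hP0⟩
    set P1 := rename Subtype.val P with hP1
    obtain ⟨A, hA⟩ := (hpg P1).1 (show aeval a P1 = 0 by rw [hP1, hre, hP])
    obtain ⟨B, hB⟩ := (hpg Q).1 hQ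
    by_cases hA0 : ι A = 0
    · refine ⟨fun j => aeval a (pderiv j P1), fun h => hs ?_, fun l => ?_⟩
      · have := congrFun h s.1
        simp only [Pi.zero_apply] at this
        rw [hP1, pderiv_rename Subtype.val_injective, hre] at this
        exact this
      · rw [hgrad P1 A hA l, hA0, zero_mul]
    · refine ⟨fun j => ι B * aeval a (pderiv j P1) - ι A * aeval a (pderiv j Q), fun h => ?_,
        fun l => ?_⟩
      · have := congrFun h t
        have h0 : pderiv t P1 = 0 := by
          apply pderiv_eq_zero_of_notMem_vars
          intro hmem
          have := vars_rename Subtype.val P hmem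
          simp at this
        simp [h0, hA0, ht] at this
      · simp_rw [sub_mul, mul_assoc]
        rw [Finset.sum_sub_distrib, ← Finset.mul_sum, ← Finset.mul_sum, hgrad P1 A hA l,
          hgrad Q B hB l]
        ring
  exfalso
  push Not at hn
  obtain ⟨v, hv⟩ := hn
  have hmem : ∀ z, z ∈ p ↔ v ∣ z := by intro z; rw [hv, Ideal.mem_span_singleton]
  obtain ⟨u, hu⟩ := (hmem w).1 hwp
  have hv0 : v ≠ 0 := by rintro rfl; simp [hu] at hw0
  have hvp : Prime v := (Ideal.span_singleton_prime hv0).1 (hv ▸ hp)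
  obtain ⟨j, hj⟩ := aux_grad v hvp
  have h1 := (hmem _).1 (hc' j)
  rw [hu, pderiv_mul, dvd_add_left (dvd_mul_right _ _)] at h1
  rcases hvp.dvd_or_dvd h1 with h | h
  · exact hj h
  · obtain ⟨u', rfl⟩ := h
    exact hvp.not_isUnit (hw v ⟨u', by rw [hu]; ring⟩)

/-- Theorem 1: for an irreducible `g ∈ k[x₁,…,xₙ]`, the following are equivalent:
(i) `g ∣ dgcd(f₁,…,f_m)`;
(ii) `g² ∣ w(f₁,…,f_m)` for some irreducible `w ∈ k[x₁,…,x_m]`;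
(iii) `g² ∣ w(f₁,…,f_m)` for some square-free `w ∈ k[x₁,…,x_m]`. -/
theorem statement0 {k : Type*} [Field k] [CharZero k] {m n : ℕ}
    (hm : 1 ≤ m) (hmn : m ≤ n)
    (f : Fin m → MvPolynomial (Fin n) k)
    (g : MvPolynomial (Fin n) k) (hg : Irreducible g)
    (d : MvPolynomial (Fin n) k) (hd : IsDgcd f d) :
    List.TFAE
      [g ∣ d,
       ∃ w : MvPolynomial (Fin m) k, Irreducible w ∧ g ^ 2 ∣ aeval f w,
       ∃ w : MvPolynomial (Fin m) k, Squarefree w ∧ g ^ 2 ∣ aeval f w] := by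
  classical
  have hgp : Prime g := hg.prime
  have hprime : (Ideal.span {g}).IsPrime := (Ideal.span_singleton_prime hgp.ne_zero).2 hgp
  let A := MvPolynomial (Fin n) k ⧸ Ideal.span {g}
  let L := FractionRing A
  let ι : MvPolynomial (Fin n) k →ₐ[k] L :=
    (IsScalarTower.toAlgHom k A L).comp (Ideal.Quotient.mkₐ k (Ideal.span {g}))
  have hι : ∀ x, ι x = 0 ↔ g ∣ x := by
    intro x
    change algebraMap A L (Ideal.Quotient.mk _ x) = 0 ↔ _
    rw [map_eq_zero_iff _ (IsFractionRing.injective A L), Ideal.Quotient.eq_zero_iff_mem,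
      Ideal.mem_span_singleton]
  let M : Matrix (Fin m) (Fin n) L := Matrix.of fun j l => ι (pderiv l (f j))
  have hdet : ∀ i : Fin m → Fin n, ι (jacDet f i) = (M.submatrix id i).det := by
    intro i
    rw [jacDet, AlgHom.map_det]
    rfl
  have hvm : ∀ c : Fin m → L, Matrix.vecMul c M = 0 ↔
      ∀ l, ∑ j, c j * ι (pderiv l (f j)) = 0 := by
    intro c
    rw [_root_.funext_iff]
    rfl
  have hgd : g ∣ d ↔ ∃ c : Fin m → L, c ≠ 0 ∧ ∀ l, ∑ j, c j * ι (pderiv l (f j)) = 0 := by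
    constructor
    · intro h
      obtain ⟨c, hc, h1⟩ := aux_rank M (fun i hi => by
        rw [← hdet, hι]; exact h.trans (hd.1 i hi))
      exact ⟨c, hc, (hvm c).1 h1⟩
    · rintro ⟨c, hc, h1⟩
      apply hd.2
      intro i _
      rw [← hι, hdet]
      by_contra hne
      apply hc
      apply Matrix.eq_zero_of_vecMul_eq_zero hne
      funext l
      exact h1 (i l)
  tfae_have 1 → 2 := by
    intro h
    obtain ⟨c, hc, h1⟩ := hgd.1 h
    exact aux_hard hm f g hgp ι hι c hc h1
  tfae_have 2 → 3 := fun ⟨w, h1, h2⟩ => ⟨w, h1.squarefree, h2⟩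
  tfae_have 3 → 1 := fun ⟨w, h1, h2⟩ => hgd.2 (aux_easy f g ι hι w h1 h2)
  tfae_finish
end

section
/- Let k be a field of characteristic zero, let f_1,…,f_m ∈ k[x_1,…,x_n] be polynomials with 1 ≤ m ≤ n, and let g ∈ k[x_1,…,x_n] be an irreducible polynomial. If g divides dgcd(f_1,…,f_m), then there exists an irreducible polynomial w ∈ k[x_1,…,x_m] such that g² divides w(f_1,…,f_m). -/
open MvPolynomial

theorem fe_of_alg {M K : Type*} [CommRing M] [IsDomain M] [CharZero M] [Field K] [Algebra M K]
    [FaithfulSMul M K] [Algebra.IsAlgebraic M K] : Algebra.FormallyEtale M K := by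
  let := FractionRing.liftAlgebra M K
  have : IsScalarTower M (FractionRing M) K := FractionRing.isScalarTower_liftAlgebra M K
  have : CharZero (FractionRing M) :=
    charZero_of_injective_algebraMap (IsFractionRing.injective M (FractionRing M))
  have : Algebra.IsAlgebraic (FractionRing M) K := (IsFractionRing.comap_isAlgebraic_iff (A := M)).1 inferInstance
  have : Algebra.FormallyEtale M (FractionRing M) :=
    Algebra.FormallyEtale.of_isLocalization (nonZeroDivisors M)
  have : Algebra.FormallyEtale (FractionRing M) K := Algebra.FormallyEtale.of_isSeparable _ _
  exact .comp _ (FractionRing M) _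

theorem exists_der_basis {k K ι : Type*} [Field k] [CharZero k] [Field K] [Algebra k K]
    (v : ι → K) (hv : IsTranscendenceBasis k v) (c : ι → K) :
    ∃ D : Derivation k K K, ∀ i, D (v i) = c i := by
  let : Algebra (MvPolynomial ι k) K := (aeval v).toAlgebra
  have : IsScalarTower k (MvPolynomial ι k) K := IsScalarTower.of_algHom (aeval v)
  have hinj : Function.Injective (algebraMap (MvPolynomial ι k) K) := hv.1
  have : FaithfulSMul (MvPolynomial ι k) K := (faithfulSMul_iff_algebraMap_injective _ _).2 hinj
  have : CharZero (MvPolynomial ι k) := inferInstance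
  have : Algebra.IsAlgebraic (MvPolynomial ι k) K := by
    have := hv.isAlgebraic
    exact Algebra.IsAlgebraic.of_ringHom_of_comp_eq (S := Algebra.adjoin k (Set.range v)) (B := K)
      (f := (hv.1.aevalEquiv : MvPolynomial ι k →+* _)) (g := RingHom.id K)
      hv.1.aevalEquiv.surjective Function.injective_id (by ext <;> simp [RingHom.algebraMap_toAlgebra])
  have := fe_of_alg (M := MvPolynomial ι k) (K := K)
  let d : Derivation k (MvPolynomial ι k) K := mkDerivation k c
  let φ := (d.liftKaehlerDifferential.liftBaseChange K).comp
    (KaehlerDifferential.tensorKaehlerEquivOfFormallyEtale k (MvPolynomial ι k) K).symm.toLinearMap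
  refine ⟨φ.compDer (KaehlerDifferential.D k K), fun i => ?_⟩
  have h : v i = algebraMap (MvPolynomial ι k) K (X i) := by
    change v i = aeval v (X i); simp
  rw [h]
  simp [φ, KaehlerDifferential.tensorKaehlerEquivOfFormallyEtale_symm_D_algebraMap, d,
    mkDerivation_X]

theorem exists_der {k K ι : Type*} [Field k] [CharZero k] [Field K] [Algebra k K]
    (v : ι → K) (hv : AlgebraicIndependent k v) (c : ι → K) :
    ∃ D : Derivation k K K, ∀ i, D (v i) = c i := by
  obtain ⟨t, ht, hb⟩ := exists_isTranscendenceBasis_superset (R := k) (s := Set.range v)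
    hv.to_subtype_range
  have hinj := hv.injective
  obtain ⟨D, hD⟩ := exists_der_basis _ hb (fun x => Function.extend v c 0 x.1)
  exact ⟨D, fun i => by rw [hD ⟨v i, ht ⟨i, rfl⟩⟩]; exact hinj.extend_apply _ _ _⟩

theorem minors {K : Type*} [Field K] {m n : ℕ} (J : Matrix (Fin m) (Fin n) K)
    (h : ∀ i : Fin m → Fin n, StrictMono i → (J.submatrix id i).det = 0) :
    ∃ s : Fin m → K, s ≠ 0 ∧ Matrix.vecMul s J = 0 := by
  by_contra! hc
  have hli : LinearIndependent K J.row := by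
    rw [← Matrix.vecMul_injective_iff]
    intro a b hab
    by_contra hne
    exact hc (a - b) (sub_ne_zero.2 hne) (by rw [Matrix.sub_vecMul]; exact sub_eq_zero.2 hab)
  have hr : J.rank = m := by simpa using hli.rank_matrix
  rw [Matrix.rank_eq_finrank_span_cols] at hr
  obtain ⟨κ, a, ha, hs, hl⟩ := exists_linearIndependent' K J.col
  have : Finite κ := Finite.of_injective a ha
  have := Fintype.ofFinite κ
  classical
  have hcard : Fintype.card κ = m := by
    rw [← hr, ← hs, finrank_span_eq_card hl]
  let T : Finset (Fin n) := Finset.univ.image a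
  have hT : T.card = m := by rw [Finset.card_image_of_injective _ ha]; exact hcard
  let i := T.orderEmbOfFin hT
  have hmem : ∀ l, ∃ x, a x = i l := fun l => by
    have := T.orderEmbOfFin_mem hT l
    rw [Finset.mem_image] at this
    obtain ⟨x, -, hx⟩ := this
    exact ⟨x, hx⟩
  choose c hcc using hmem
  have hci : Function.Injective c := fun x y hxy => i.injective (by rw [← hcc, ← hcc, hxy])
  have h2 := hl.comp c hci
  have h3 : LinearIndependent K (J.submatrix id i).col := by
    have he : (J.submatrix id i).col = (J.col ∘ a) ∘ c := by
      ext l j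
      simp only [Function.comp_apply, hcc]
      rfl
    rw [he]; exact h2
  rw [Matrix.linearIndependent_cols_iff_isUnit, Matrix.isUnit_iff_isUnit_det] at h3
  exact h3.ne_zero (h i i.strictMono)

namespace Polynomial
noncomputable def wtHom (D : Type*) [CommRing D] (A B : ℕ) : D[X][X] →+* D[X][X] :=
  eval₂RingHom (eval₂RingHom (C.comp C) (X ^ B)) (C X * X ^ A)

theorem wtHom_coeff {D : Type*} [CommRing D] (A B : ℕ) (hB : 0 < B) (r : D[X][X]) (i y : ℕ) :
    ((wtHom D A B r).coeff i).coeff y =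
      if A * y ≤ i ∧ B ∣ (i - A * y) then (r.coeff y).coeff ((i - A * y) / B) else 0 := by
  induction r using Polynomial.induction_on' with
  | add p q hp hq => simp only [map_add, coeff_add, hp, hq]; split_ifs <;> simp
  | monomial y' p =>
    induction p using Polynomial.induction_on' with
    | add p q hp hq => simp only [map_add, coeff_add, hp, hq]; split_ifs <;> simp
    | monomial x d =>
      have : wtHom D A B (monomial y' (monomial x d))
          = monomial (B * x + A * y') (monomial y' d) := by
        simp only [wtHom, coe_eval₂RingHom, RingHom.comp_apply,
          ← C_mul_X_pow_eq_monomial, map_mul, map_pow, eval₂_C, eval₂_X]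
        ring
      rw [this]
      simp only [coeff_monomial]
      by_cases hy : y' = y
      · subst hy
        by_cases hi : B * x + A * y' = i
        · subst hi
          simp [hB]
        · rw [if_neg hi]
          split_ifs with h1 h2 <;> simp
          rw [coeff_monomial, if_neg]
          rintro rfl
          apply hi
          rw [Nat.mul_div_cancel' h1.2]; omega
      · rw [apply_ite (fun p : D[X] => p.coeff y)]
        simp [coeff_monomial, hy]

theorem wt_factor {D : Type*} [CommRing D] [IsDomain D] (a b : D[X])
    (hab : Nat.Coprime a.natDegree b.natDegree) (ha : 0 < a.natDegree) (hb : 0 < b.natDegree)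
    (r s : D[X][X]) (h : r * s = C a + b.map C) :
    (∃ d, r = C (C d)) ∨ ∃ d, s = C (C d) := by
  set A := a.natDegree with hA
  set B := b.natDegree with hBd
  let Φ := wtHom D A B
  have hΦ := wtHom_coeff (D := D) A B hb
  have key : ∀ (r : D[X][X]) (i y : ℕ), ((Φ r).coeff i).coeff y ≠ 0 →
      ∃ x, i = B * x + A * y ∧ (r.coeff y).coeff x ≠ 0 := by
    intro r i y hne
    rw [hΦ] at hne
    split_ifs at hne with h1
    · obtain ⟨h1, x, hx⟩ := h1
      refine ⟨x, by omega, ?_⟩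
      rwa [hx, Nat.mul_div_cancel_left _ hb] at hne
    · exact absurd rfl hne
  have key2 : ∀ (r : D[X][X]) (x y : ℕ), ((Φ r).coeff (B * x + A * y)).coeff y = (r.coeff y).coeff x := by
    intro r x y
    rw [hΦ]; simp [hb]
  set F : D[X][X] := C a + b.map C with hF
  have hFc : ∀ x y, (F.coeff y).coeff x = (if y = 0 then a.coeff x else 0) +
      (if x = 0 then b.coeff y else 0) := by
    intro x y
    simp only [hF, coeff_add, coeff_map, coeff_C]
    split_ifs <;> simp
  have hFne : ∀ x y, (F.coeff y).coeff x ≠ 0 → (y = 0 ∧ x ≤ A) ∨ (x = 0 ∧ y ≤ B) := by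
    intro x y hne
    rw [hFc] at hne
    by_contra! hcon
    apply hne
    have h1 : (if y = 0 then a.coeff x else 0) = 0 := by
      split_ifs with h
      · exact coeff_eq_zero_of_natDegree_lt (hcon.1 h)
      · rfl
    have h2 : (if x = 0 then b.coeff y else 0) = 0 := by
      split_ifs with h
      · exact coeff_eq_zero_of_natDegree_lt (hcon.2 h)
      · rfl
    rw [h1, h2, add_zero]
  have h0 : ((Φ F).coeff (A * B)).coeff 0 ≠ 0 := by
    have := key2 F A 0
    rw [hFc] at this
    simp only [mul_zero, add_zero, if_true, ha.ne', if_false] at this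
    rw [mul_comm, this]
    exact leadingCoeff_ne_zero.2 (fun h => by simp [hA, h] at ha)
  have h0' : ((Φ F).coeff (A * B)).coeff B ≠ 0 := by
    have := key2 F 0 B
    rw [hFc] at this
    simp only [mul_zero, zero_add, if_true, hb.ne', if_false] at this
    rw [this]
    exact leadingCoeff_ne_zero.2 (fun h => by simp [hBd, h] at hb)
  have hdeg : (Φ F).natDegree = A * B := by
    apply le_antisymm
    · rw [natDegree_le_iff_coeff_eq_zero]
      intro N hN
      ext y
      by_contra hne
      obtain ⟨x, hx, hx2⟩ := key F N y hne
      rcases hFne x y hx2 with ⟨rfl, h⟩ | ⟨rfl, h⟩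
      · nlinarith
      · nlinarith
    · exact le_natDegree_of_ne_zero (fun h => h0 (by rw [h]; simp))
  have hlc : (Φ F).leadingCoeff.natDegree = B := by
    rw [leadingCoeff, hdeg]
    apply le_antisymm
    · rw [natDegree_le_iff_coeff_eq_zero]
      intro y hy
      by_contra hne
      obtain ⟨x, hx, hx2⟩ := key F _ y hne
      rcases hFne x y hx2 with ⟨rfl, h⟩ | ⟨rfl, h⟩ <;> omega
    · exact le_natDegree_of_ne_zero h0'
  have hprod : Φ r * Φ s = Φ F := by rw [← map_mul, h]
  have hFn : Φ F ≠ 0 := fun h => h0 (by rw [h]; simp)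
  have hrn : Φ r ≠ 0 := fun h => hFn (by rw [← hprod, h, zero_mul])
  have hsn : Φ s ≠ 0 := fun h => hFn (by rw [← hprod, h, mul_zero])
  have hd : (Φ r).natDegree + (Φ s).natDegree = A * B := by
    rw [← natDegree_mul hrn hsn, hprod, hdeg]
  have hl : (Φ r).leadingCoeff * (Φ s).leadingCoeff = (Φ F).leadingCoeff := by
    rw [← leadingCoeff_mul, hprod]
  have hl0 : (Φ r).leadingCoeff.coeff 0 ≠ 0 := by
    intro h
    apply h0
    rw [← hdeg, coeff_natDegree, ← hl, mul_coeff_zero, h, zero_mul]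
  have hy : (Φ r).leadingCoeff.natDegree + (Φ s).leadingCoeff.natDegree = B := by
    rw [← natDegree_mul (leadingCoeff_ne_zero.2 hrn) (leadingCoeff_ne_zero.2 hsn), hl, hlc]
  obtain ⟨x, hx, -⟩ := key r _ 0 hl0
  obtain ⟨x1, hx1, -⟩ := key r (Φ r).natDegree (Φ r).leadingCoeff.natDegree
    (leadingCoeff_ne_zero.2 (leadingCoeff_ne_zero.2 hrn))
  obtain ⟨x2, hx2, -⟩ := key s (Φ s).natDegree (Φ s).leadingCoeff.natDegree
    (leadingCoeff_ne_zero.2 (leadingCoeff_ne_zero.2 hsn))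
  have fin : ∀ r : D[X][X], (Φ r).natDegree = 0 → ∃ d, r = C (C d) := by
    intro r hr
    refine ⟨(r.coeff 0).coeff 0, ?_⟩
    ext y x
    by_cases hne : (r.coeff y).coeff x = 0
    · rw [hne, coeff_C]
      split_ifs with h1
      · rw [coeff_C]
        split_ifs with h2
        · subst h1 h2; exact hne.symm
        · rfl
      · simp
    · rw [← key2] at hne
      have := le_natDegree_of_ne_zero (fun h => hne (by rw [h]; simp) : (Φ r).coeff (B * x + A * y) ≠ 0)
      rw [hr] at this
      have hx0 : x = 0 := by
        rcases Nat.eq_zero_or_pos x with h | h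
        · exact h
        · nlinarith
      have hy0 : y = 0 := by
        rcases Nat.eq_zero_or_pos y with h | h
        · exact h
        · nlinarith
      subst hx0 hy0
      simp
  set y1 := (Φ r).leadingCoeff.natDegree
  set y2 := (Φ s).leadingCoeff.natDegree
  set i := (Φ r).natDegree
  set j := (Φ s).natDegree
  have hxx : B * (x1 + x2) = 0 := by
    have : A * y1 + A * y2 = A * B := by rw [← mul_add, hy]
    rw [mul_add]; omega
  have hx10 : x1 = 0 := by
    rcases Nat.mul_eq_zero.1 hxx with h | h <;> omega
  subst hx10
  have hdvd : B ∣ A * y1 := ⟨x, by omega⟩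
  have hdvd' : B ∣ y1 := (Nat.Coprime.symm hab).dvd_of_dvd_mul_left hdvd
  obtain ⟨z, hz⟩ := hdvd'
  rcases Nat.eq_zero_or_pos z with hz0 | hz0
  · left
    apply fin
    change i = 0
    rw [hx1, hz, hz0]; simp
  · right
    apply fin
    change j = 0
    have : y1 = B := by nlinarith
    rw [this] at hx1
    omega

end Polynomial

theorem exists_prime_factor {T K : Type*} [CommRing T] [IsDomain T] [UniqueFactorizationMonoid T]
    [Field K] (φ : T →+* K) (F : T) (hF : F ≠ 0) (h : φ F = 0) :
    ∃ w, Prime w ∧ w ∣ F ∧ φ w = 0 := by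
  induction F using UniqueFactorizationMonoid.induction_on_prime with
  | h₁ => exact absurd rfl hF
  | h₂ x hx => exact absurd h (hx.map φ).ne_zero
  | h₃ a p ha hp ih =>
    rw [map_mul, mul_eq_zero] at h
    rcases h with h | h
    · exact ⟨p, hp, dvd_mul_right _ _, h⟩
    · obtain ⟨w, h1, h2, h3⟩ := ih ha h
      exact ⟨w, h1, h2.mul_left _, h3⟩

theorem prime_equiv {R S : Type*} [CommRing R] [CommRing S] (e : R ≃+* S) (w : R)
    (hw : Prime w) : Prime (e w) :=
  (MulEquiv.prime_iff e).2 hw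

theorem chain_rule {k R σ : Type*} [Field k] [CommRing R] [Algebra k R] [Fintype σ]
    (D : Derivation k R R) (x : σ → R) (p : MvPolynomial σ k) :
    D (aeval x p) = ∑ i, aeval x (pderiv i p) * D (x i) := by
  classical
  induction p using MvPolynomial.induction_on with
  | C a => simp [algHom_C]
  | add p q hp hq => simp [hp, hq, add_mul, Finset.sum_add_distrib]
  | mul_X p j hp =>
    simp only [map_mul, aeval_X, Derivation.leibniz, hp, smul_eq_mul, pderiv_X, map_add, add_mul,
      Finset.sum_add_distrib, Finset.mul_sum]
    congr 1
    · simp [Pi.single_apply, apply_ite]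
    · exact Finset.sum_congr rfl fun i _ => by ring

theorem exists_pderiv_not_dvd {k : Type*} [Field k] [CharZero k] {n : ℕ}
    (g : MvPolynomial (Fin n) k) (hg : Irreducible g) : ∃ i, ¬ g ∣ pderiv i g := by
  by_contra! hc
  have h0 : ∀ i, pderiv i g = 0 := by
    intro i
    by_contra hne
    have h1 := totalDegree_le_of_dvd_of_isDomain (hc i) hne
    obtain ⟨t, ht, htd⟩ := Finset.exists_mem_eq_sup _ (support_nonempty.2 hne)
      (fun s : Fin n →₀ ℕ => s.sum fun _ e => e)
    have h2 : t + Finsupp.single i 1 ∈ g.support := by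
      rw [mem_support_iff] at ht ⊢
      intro h
      rw [coeff_pderiv, h, zero_mul] at ht
      exact ht rfl
    have h3 := le_totalDegree h2
    have h4 : (pderiv i g).totalDegree = t.sum fun _ e => e := htd
    rw [Finsupp.sum_add_index' (by simp) (by simp), Finsupp.sum_single_index rfl] at h3
    omega
  have hC : g = C (coeff 0 g) := by
    ext t
    rw [coeff_C]
    split_ifs with h
    · rw [h]
    · obtain ⟨i, hi⟩ : ∃ i, t i ≠ 0 := by
        by_contra! h'
        exact h (by ext i; simp [h' i])
      have h1 := congrArg (coeff (t - Finsupp.single i 1)) (h0 i)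
      have h2 : t - Finsupp.single i 1 + Finsupp.single i 1 = t := by
        apply tsub_add_cancel_of_le
        rw [Finsupp.single_le_iff]
        omega
      rw [coeff_pderiv, h2, coeff_zero, mul_eq_zero] at h1
      rcases h1 with h1 | h1
      · exact h1
      · exact absurd h1 (Nat.cast_add_one_ne_zero _)
  by_cases hz : coeff 0 g = 0
  · exact hg.ne_zero (by rw [hC, hz, C_0])
  · apply hg.not_isUnit
    rw [hC]
    exact (IsUnit.mk0 _ hz).map C

theorem der_apply {k K : Type*} [Field k] [Field K] [Algebra k K] {n : ℕ}
    (π : MvPolynomial (Fin n) k →ₐ[k] K) (D : Derivation k K K) (a : MvPolynomial (Fin n) k) :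
    D (π a) = ∑ i, π (pderiv i a) * D (π (X i)) := by
  have h : π = aeval (fun i => π (X i)) := by ext i; simp
  have := chain_rule D (fun i => π (X i)) a
  rw [← h] at this
  exact this

theorem rel_apply {k K : Type*} [Field k] [Field K] [Algebra k K] {m n : ℕ}
    (π : MvPolynomial (Fin n) k →ₐ[k] K) (f : Fin m → MvPolynomial (Fin n) k)
    (s : Fin m → K) (hs : ∀ i, ∑ j, s j * π (pderiv i (f j)) = 0) (D : Derivation k K K) :
    ∑ j, s j * D (π (f j)) = 0 := by
  simp only [der_apply π D (f _), Finset.mul_sum]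
  rw [Finset.sum_comm]
  simp only [← mul_assoc, ← Finset.sum_mul, hs, zero_mul, Finset.sum_const_zero]

theorem case_all {k K : Type*} [Field k] [CharZero k] [Field K] [Algebra k K] {m n : ℕ}
    (π : MvPolynomial (Fin n) k →ₐ[k] K) (f : Fin m → MvPolynomial (Fin n) k)
    (s : Fin m → K) (hs0 : s ≠ 0) (hs : ∀ i, ∑ j, s j * π (pderiv i (f j)) = 0)
    (hv : AlgebraicIndependent k (fun j => π (f j))) : False := by
  apply hs0
  ext j
  obtain ⟨D, hD⟩ := exists_der _ hv (Pi.single j 1)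
  have := rel_apply π f s hs D
  simpa [hD, Pi.single_apply] using this

theorem case_one {k K : Type*} [Field k] [CharZero k] [Field K] [Algebra k K] {m n : ℕ}
    (g : MvPolynomial (Fin n) k) (hg : Irreducible g)
    (π : MvPolynomial (Fin n) k →ₐ[k] K) (hπ : ∀ a, π a = 0 ↔ g ∣ a)
    (f : Fin m → MvPolynomial (Fin n) k)
    (s : Fin m → K) (hs0 : s ≠ 0) (hs : ∀ i, ∑ j, s j * π (pderiv i (f j)) = 0) (v : Fin m)
    (hv : AlgebraicIndependent k (fun j : {j // j ≠ v} => π (f j)))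
    (w : MvPolynomial (Fin m) k) (hw : g ∣ aeval f w) : g ^ 2 ∣ aeval f w := by
  have hD : ∀ j : {j // j ≠ v}, ∃ D : Derivation k K K,
      ∀ i : {j // j ≠ v}, D (π (f i)) = (Pi.single j 1 : {j // j ≠ v} → K) i :=
    fun j => exists_der _ hv _
  choose D hD using hD
  have hrel : ∀ t : Fin m → K, ∀ j : {j // j ≠ v}, ∑ i, t i * D j (π (f i)) = 0 →
      t j = - t v * D j (π (f v)) := by
    intro t j h
    rw [← Finset.add_sum_erase _ _ (Finset.mem_univ v), Finset.sum_eq_single j.1] at h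
    · have h1 : D j (π (f j)) = 1 := by rw [hD j j]; simp
      rw [h1] at h
      linear_combination h
    · intro b hb hbj
      have hbv := Finset.ne_of_mem_erase hb
      rw [hD j ⟨b, hbv⟩, Pi.single_apply, if_neg, mul_zero]
      intro h; exact hbj (congrArg Subtype.val h)
    · intro h; exact absurd (Finset.mem_erase.2 ⟨j.2, Finset.mem_univ _⟩) h
  have hs1 : ∀ j : {j // j ≠ v}, s j = - s v * D j (π (f v)) :=
    fun j => hrel s j (rel_apply π f s hs (D j))
  have hsv : s v ≠ 0 := by
    intro h
    apply hs0
    ext j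
    by_cases hj : j = v
    · rw [hj, h]; rfl
    · have := hs1 ⟨j, hj⟩
      simp only at this
      rw [this, h]; simp
  obtain ⟨h, hh⟩ := hw
  have hch : ∀ i, ∑ j, π (aeval f (pderiv j w)) * π (pderiv i (f j)) = π h * π (pderiv i g) := by
    intro i
    have h1 := chain_rule (pderiv i) f w
    rw [hh, Derivation.leibniz] at h1
    have h2 := congrArg π h1
    have hg0 : π g = 0 := (hπ g).2 dvd_rfl
    simp only [map_add, smul_eq_mul, map_mul, hg0, zero_mul, zero_add, map_sum] at h2
    exact h2.symm
  have hπw : π (aeval f w) = aeval (fun j => π (f j)) w := by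
    rw [MvPolynomial.comp_aeval_apply]
  have hw1 : ∀ j : {j // j ≠ v}, π (aeval f (pderiv j.1 w))
      = - π (aeval f (pderiv v w)) * D j (π (f v)) := by
    intro j
    refine hrel (fun j => π (aeval f (pderiv j w))) j ?_
    have h1 := chain_rule (D j) (fun j => π (f j)) w
    rw [← hπw, hh, (hπ _).2 (dvd_mul_right _ _), map_zero] at h1
    rw [h1]
    refine Finset.sum_congr rfl fun i _ => ?_
    rw [MvPolynomial.comp_aeval_apply]
  obtain ⟨c, hprop⟩ : ∃ c, ∀ j, π (aeval f (pderiv j w)) = c * s j := by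
    refine ⟨π (aeval f (pderiv v w)) / s v, fun j => ?_⟩
    by_cases hj : j = v
    · rw [hj]; field_simp
    · have h1 := hs1 ⟨j, hj⟩
      have h2 := hw1 ⟨j, hj⟩
      simp only at h1 h2
      rw [h2, h1]; field_simp
  obtain ⟨i, hi⟩ := exists_pderiv_not_dvd g hg
  have h3 := hch i
  simp only [hprop, mul_assoc] at h3
  rw [← Finset.mul_sum, hs, mul_zero] at h3
  have h4 : π h = 0 := by
    rcases mul_eq_zero.1 h3.symm with h | h
    · exact h
    · exact absurd ((hπ _).1 h) hi
  rw [hh, sq]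
  exact mul_dvd_mul_left g ((hπ _).1 h4)

set_option maxHeartbeats 4000000 in
open scoped Polynomial in
theorem case_two {k K : Type*} [Field k] [Field K] [Algebra k K] {m n : ℕ}
    (g : MvPolynomial (Fin n) k) (hg : Irreducible g)
    (π : MvPolynomial (Fin n) k →ₐ[k] K) (hπ : ∀ a, π a = 0 ↔ g ∣ a)
    (f : Fin m → MvPolynomial (Fin n) k) {σ : Type}
    (ι : Option (Option σ) → Fin m) (hι : Function.Injective ι)
    (hS : AlgebraicIndependent k (fun j : σ => π (f (ι (some (some j))))))
    (hu : ¬ AlgebraicIndependent k (fun j : Option σ => π (f (ι (some j)))))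
    (hv : ¬ AlgebraicIndependent k (fun j : Option σ => π (f (ι (Option.map some j))))) :
    ∃ w : MvPolynomial (Fin m) k, Irreducible w ∧ g ^ 2 ∣ aeval f w := by
  rw [algebraicIndependent_iff] at hu hv
  push Not at hu hv
  obtain ⟨P, hP, hP0⟩ := hu
  obtain ⟨Q, hQ, hQ0⟩ := hv
  let E : MvPolynomial (Option (Option σ)) k ≃ₐ[k] (MvPolynomial σ k)[X][X] :=
    (optionEquivLeft k (Option σ)).trans (Polynomial.mapAlgEquiv (optionEquivLeft k σ))
  have E0 : ∀ d, E (rename (some ∘ some) d) = Polynomial.C (Polynomial.C d) := by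
    intro d
    induction d using MvPolynomial.induction_on with
    | C a => simp [E]
    | add p q hp hq => simp only [map_add, hp, hq]
    | mul_X p j hp => simp only [map_mul, hp]; congr 1; simp [E]
  have E1 : ∀ d, E (rename some d) = Polynomial.C (optionEquivLeft k σ d) := by
    intro d
    induction d using MvPolynomial.induction_on with
    | C a => simp [E]
    | add p q hp hq => simp only [map_add, hp, hq]
    | mul_X p j hp => simp only [map_mul, hp]; congr 1; simp [E]
  have E2 : ∀ d, E (rename (Option.map some) d) = (optionEquivLeft k σ d).map Polynomial.C := by
    intro d
    induction d using MvPolynomial.induction_on with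
    | C a => simp [E]
    | add p q hp hq => simp only [map_add, hp, hq, Polynomial.map_add]
    | mul_X p j hp =>
      simp only [map_mul, hp, Polynomial.map_mul]; congr 1; cases j <;> simp [E]
  set p := optionEquivLeft k σ P with hp
  set q := optionEquivLeft k σ Q with hq
  have hpn : p ≠ 0 := by simpa [hp] using hP0
  have hqn : q ≠ 0 := by simpa [hq] using hQ0
  let a := Polynomial.X ^ (2 * q.natDegree + 1) * p ^ 2
  let b := Polynomial.X ^ (2 * p.natDegree + 2) * q ^ 2
  have ha : a.natDegree = 2 * p.natDegree + 2 * q.natDegree + 1 := by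
    simp only [a]
    rw [Polynomial.natDegree_mul (by simp) (by simpa using hpn)]
    simp; ring
  have hb : b.natDegree = 2 * p.natDegree + 2 * q.natDegree + 1 + 1 := by
    simp only [b]
    rw [Polynomial.natDegree_mul (by simp) (by simpa using hqn)]
    simp; ring
  let F : (MvPolynomial σ k)[X][X] := Polynomial.C a + b.map Polynomial.C
  have hF0 : F ≠ 0 := by
    intro h
    have h' : Polynomial.C a + b.map Polynomial.C = 0 := h
    have h2 := congrArg (fun x => Polynomial.coeff x b.natDegree) h'
    simp only [Polynomial.coeff_add, Polynomial.coeff_map, Polynomial.coeff_zero] at h2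
    rw [Polynomial.coeff_C_of_ne_zero (by omega), zero_add, Polynomial.C_eq_zero] at h2
    have h3 := Polynomial.leadingCoeff_eq_zero.1 h2
    rw [h3, Polynomial.natDegree_zero] at hb
    omega
  let ev : (MvPolynomial σ k)[X][X] →ₐ[k] MvPolynomial (Fin n) k :=
    ((aeval f).comp (rename ι)).comp E.symm.toAlgHom
  have hev : ∀ x, ev (E x) = aeval (fun j => f (ι j)) x := by
    intro x
    change aeval f (rename ι (E.symm (E x))) = _
    rw [AlgEquiv.symm_apply_apply, aeval_rename]
    rfl
  have hπa : ∀ {τ : Type} (h : τ → MvPolynomial (Fin n) k) (x : MvPolynomial τ k),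
      π (aeval h x) = aeval (fun j => π (h j)) x := by
    intro τ h x
    rw [MvPolynomial.comp_aeval_apply]
  have hgp : g ∣ ev (Polynomial.C p) := by
    rw [← hπ, hp, ← E1, hev, aeval_rename, hπa]
    exact hP
  have hgq : g ∣ ev (q.map Polynomial.C) := by
    rw [← hπ, hq, ← E2, hev, aeval_rename, hπa]
    exact hQ
  have hgF : g ^ 2 ∣ ev F := by
    simp only [F, a, b, Polynomial.map_mul, Polynomial.map_pow, map_mul, map_pow, map_add]
    exact dvd_add (Dvd.dvd.mul_left (pow_dvd_pow_of_dvd hgp 2) _)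
      (Dvd.dvd.mul_left (pow_dvd_pow_of_dvd hgq 2) _)
  have hc : ∀ d, π (ev (Polynomial.C (Polynomial.C d))) = 0 → d = 0 := by
    intro d hd
    rw [← E0, hev, aeval_rename, hπa] at hd
    exact (algebraicIndependent_iff.1 hS) d hd
  obtain ⟨w, hw, ⟨c, hwc⟩, hw0⟩ := exists_prime_factor (π.comp ev : _ →+* K) F hF0
    ((hπ _).2 ((dvd_pow_self g two_ne_zero).trans hgF))
  have hcn : ¬ g ∣ ev c := by
    rw [← hπ]
    intro h0
    rcases Polynomial.wt_factor a b (by rw [ha, hb]; simp) (by omega) (by omega) w c hwc.symm with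
      ⟨d, rfl⟩ | ⟨d, rfl⟩
    · exact hw.ne_zero (by rw [hc d hw0]; simp)
    · exact hF0 (by rw [hwc, hc d h0]; simp)
  have hgw : g ^ 2 ∣ ev w := by
    rw [hwc, map_mul] at hgF
    exact hg.prime.pow_dvd_of_dvd_mul_right 2 hcn hgF
  refine ⟨rename ι (E.symm w), ?_, hgw⟩
  have h1 : Prime (E.symm w) := prime_equiv E.symm.toRingEquiv w hw
  have h2 : Prime (rename (Equiv.ofInjective ι hι) (E.symm w)) :=
    (MulEquiv.prime_iff (renameEquiv k (Equiv.ofInjective ι hι))).2 h1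
  have h3 := (prime_rename_iff (Set.range ι)).2 h2
  rw [rename_rename] at h3
  exact h3.irreducible

theorem algInd_insert {k K : Type*} [Field k] [Field K] [Algebra k K] {m : ℕ}
    (y : Fin m → K) (S : Finset (Fin m)) (u : Fin m) (x : Option {j // j ∈ S} → K)
    (hx0 : x none = y u) (hx1 : ∀ j : {j // j ∈ S}, x (some j) = y j)
    (h : AlgebraicIndependent k x) :
    AlgebraicIndependent k (fun j : {j // j ∈ insert u S} => y j) := by
  classical
  let r : {j // j ∈ insert u S} → Option {j // j ∈ S} :=
    fun j => if h : j.1 ∈ S then some ⟨j.1, h⟩ else none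
  have hr : Function.Injective r := by
    rintro ⟨a, ha⟩ ⟨b, hb⟩ hab
    simp only [r] at hab
    rw [Finset.mem_insert] at ha hb
    apply Subtype.ext
    change a = b
    by_cases h1 : a ∈ S <;> by_cases h2 : b ∈ S <;> simp [h1, h2] at hab
    · exact hab
    · rw [ha.resolve_right h1, hb.resolve_right h2]
  have := h.comp r hr
  convert this using 1
  ext ⟨a, ha⟩
  simp only [Function.comp_apply, r]
  split_ifs with h1
  · rw [hx1]
  · rw [hx0, (Finset.mem_insert.1 ha).resolve_right h1]

set_option maxHeartbeats 4000000 in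
theorem main_aux {k K : Type*} [Field k] [CharZero k] [Field K] [Algebra k K] {m n : ℕ}
    (g : MvPolynomial (Fin n) k) (hg : Irreducible g)
    (π : MvPolynomial (Fin n) k →ₐ[k] K) (hπ : ∀ a, π a = 0 ↔ g ∣ a)
    (f : Fin m → MvPolynomial (Fin n) k)
    (s : Fin m → K) (hs0 : s ≠ 0) (hs : ∀ i, ∑ j, s j * π (pderiv i (f j)) = 0) :
    ∃ w : MvPolynomial (Fin m) k, Irreducible w ∧ g ^ 2 ∣ aeval f w := by
  classical
  let P : Finset (Fin m) → Prop :=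
    fun S => AlgebraicIndependent k (fun j : {j // j ∈ S} => π (f j))
  have hP0 : P ∅ := by
    have : IsEmpty {j : Fin m // j ∈ (∅ : Finset (Fin m))} := ⟨fun x => Finset.notMem_empty _ x.2⟩
    exact algebraicIndependent_empty_type
  obtain ⟨S, hS, hmax⟩ := Finset.exists_max_image
    ((Finset.univ : Finset (Finset (Fin m))).filter P) Finset.card ⟨∅, by simp [hP0]⟩
  have hPS : AlgebraicIndependent k (fun j : {j // j ∈ S} => π (f j)) := (Finset.mem_filter.1 hS).2
  have hins : ∀ u, u ∉ S → ¬ P (insert u S) := by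
    intro u hu hPu
    have := hmax _ (Finset.mem_filter.2 ⟨Finset.mem_univ _, hPu⟩)
    rw [Finset.card_insert_of_notMem hu] at this
    omega
  have hnot : ¬ AlgebraicIndependent k (fun j => π (f j)) :=
    fun h => case_all π f s hs0 hs h
  obtain ⟨v, hv⟩ : ∃ v, v ∉ S := by
    by_contra! hall
    apply hnot
    have h1 := AlgebraicIndependent.comp hPS (fun j : Fin m => (⟨j, hall j⟩ : {j // j ∈ S}))
      (fun a b h => congrArg Subtype.val h)
    exact h1
  by_cases hone : ∀ u, u ≠ v → u ∈ S
  · have hvi : AlgebraicIndependent k (fun j : {j // j ≠ v} => π (f j)) := by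
      have hinj : Function.Injective
          (fun j : {j // j ≠ v} => (⟨j.1, hone j.1 j.2⟩ : {j // j ∈ S})) := by
        intro a b h
        apply Subtype.ext
        exact Subtype.mk.inj h
      have h1 := AlgebraicIndependent.comp hPS _ hinj
      exact h1
    rw [algebraicIndependent_iff] at hnot
    push Not at hnot
    obtain ⟨W, hW, hW0⟩ := hnot
    have hπa : π (aeval f W) = 0 := by
      rw [MvPolynomial.comp_aeval_apply]; exact hW
    obtain ⟨w, hw, -, hw0⟩ := exists_prime_factor (π.comp (aeval f) : _ →+* K) W hW0 hπa
    exact ⟨w, hw.irreducible,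
      case_one g hg π hπ f s hs0 hs v hvi w ((hπ _).1 hw0)⟩
  · push Not at hone
    obtain ⟨u, huv, hu⟩ := hone
    let ι : Option (Option {j // j ∈ S}) → Fin m
      | none => v
      | some none => u
      | some (some j) => j.1
    have hι : Function.Injective ι := by
      rintro (_ | _ | a) (_ | _ | b) hab
      · rfl
      · exact absurd hab.symm huv
      · exact absurd ((show v = b.1 from hab) ▸ b.2 : v ∈ S) hv
      · exact absurd hab huv
      · rfl
      · exact absurd ((show u = b.1 from hab) ▸ b.2 : u ∈ S) hu
      · exact absurd ((show a.1 = v from hab) ▸ a.2 : v ∈ S) hv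
      · exact absurd ((show a.1 = u from hab) ▸ a.2 : u ∈ S) hu
      · exact congrArg (fun x => some (some x)) (Subtype.ext hab)
    exact case_two g hg π hπ f ι hι hPS
      (fun h => hins u hu (algInd_insert (fun j => π (f j)) S u _ rfl (fun _ => rfl) h))
      (fun h => hins v hv (algInd_insert (fun j => π (f j)) S v _ rfl (fun _ => rfl) h))

/-- If `g ∣ dgcd(f₁,…,f_m)`, then `g² ∣ w(f₁,…,f_m)` for some irreducible
polynomial `w ∈ k[x₁,…,x_m]`. -/
theorem statement1 {k : Type*} [Field k] [CharZero k] {m n : ℕ}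
    (hm : 1 ≤ m) (hmn : m ≤ n)
    (f : Fin m → MvPolynomial (Fin n) k)
    (g : MvPolynomial (Fin n) k) (hg : Irreducible g)
    (d : MvPolynomial (Fin n) k) (hd : IsDgcd f d)
    (hdvd : g ∣ d) :
    ∃ w : MvPolynomial (Fin m) k, Irreducible w ∧ g ^ 2 ∣ aeval f w := by
  have hp := hg.prime
  have : (Ideal.span {g}).IsPrime := (Ideal.span_singleton_prime hg.ne_zero).2 hp
  let A := MvPolynomial (Fin n) k ⧸ Ideal.span {g}
  let K := FractionRing A
  let π : MvPolynomial (Fin n) k →ₐ[k] K :=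
    (IsScalarTower.toAlgHom k A K).comp (Ideal.Quotient.mkₐ k (Ideal.span {g}))
  have hπ : ∀ a, π a = 0 ↔ g ∣ a := by
    intro a
    have h1 : π a = algebraMap A K (Ideal.Quotient.mk (Ideal.span {g}) a) := rfl
    rw [h1, FaithfulSMul.algebraMap_eq_zero_iff, Ideal.Quotient.eq_zero_iff_mem,
      Ideal.mem_span_singleton]
  obtain ⟨s, hs0, hs⟩ := minors (Matrix.of fun (j : Fin m) (l : Fin n) => π (pderiv l (f j))) (by
    intro i hi
    have h1 : π (jacDet f i) = 0 := (hπ _).2 (hdvd.trans (hd.1 i hi))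
    rw [jacDet, AlgHom.map_det] at h1
    exact h1)
  refine main_aux g hg π hπ f s hs0 fun i => ?_
  have := congrFun hs i
  simpa [Matrix.vecMul, dotProduct] using this
end

section
/- Let k be a field of characteristic zero, let f_1,…,f_m ∈ k[x_1,…,x_n] be polynomials with 1 ≤ m ≤ n, and let g ∈ k[x_1,…,x_n] be an irreducible polynomial. If there exists a square-free polynomial w ∈ k[x_1,…,x_m] such that g² divides w(f_1,…,f_m), then there exists an irreducible polynomial w₁ ∈ k[x_1,…,x_m] such that g² divides w₁(f_1,…,f_m). -/
open MvPolynomial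

lemma aux_factor {A : Type*} [CommRing A] [IsDomain A] [UniqueFactorizationMonoid A]
    (P : Ideal A) [hP : P.IsPrime] (w : A) (hw : w ≠ 0) (hwP : w ∈ P) :
    ∃ u ∈ P, Prime u ∧ u ∣ w := by
  obtain ⟨s, hs, hsw⟩ := UniqueFactorizationMonoid.exists_prime_factors w hw
  have h1 : s.prod ∈ P := P.mem_of_dvd hsw.symm.dvd hwP
  obtain ⟨u, hu, huP⟩ := (hP.multiset_prod_mem_iff_exists_mem s).1 h1
  exact ⟨u, huP, hs u hu, (Multiset.dvd_prod hu).trans hsw.dvd⟩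

lemma aux_bezout {R : Type*} [CommRing R] [IsDomain R] [UniqueFactorizationMonoid R]
    (u v : Polynomial R) (hu : Prime u) (hv : Prime v) (huv : ¬ Associated u v) :
    ∃ r : R, r ≠ 0 ∧ ∃ a b, Polynomial.C r = a * u + b * v := by
  classical
  let := (Classical.choice (inferInstance : Nonempty (NormalizedGCDMonoid R)))
  by_cases hu0 : u.natDegree = 0
  · rw [Polynomial.natDegree_eq_zero] at hu0
    obtain ⟨r, rfl⟩ := hu0
    refine ⟨r, ?_, 1, 0, by simp⟩
    rintro rfl
    exact hu.ne_zero (by simp)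
  by_cases hv0 : v.natDegree = 0
  · rw [Polynomial.natDegree_eq_zero] at hv0
    obtain ⟨r, rfl⟩ := hv0
    refine ⟨r, ?_, 0, 1, by simp⟩
    rintro rfl
    exact hv.ne_zero (by simp)
  have pu := hu.irreducible.isPrimitive hu0
  have pv := hv.irreducible.isPrimitive hv0
  let K := FractionRing R
  have iu := (pu.irreducible_iff_irreducible_map_fraction_map (K := K)).1 hu.irreducible
  have hcop : IsCoprime (u.map (algebraMap R K)) (v.map (algebraMap R K)) := by
    rw [iu.coprime_iff_not_dvd]
    intro hd
    have := pu.dvd_of_fraction_map_dvd_fraction_map hd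
    exact huv (hu.associated_of_dvd hv this)
  obtain ⟨a, b, hab⟩ := hcop
  obtain ⟨c, hc, hca⟩ := IsLocalization.integerNormalization_spec (nonZeroDivisors R) a
  obtain ⟨d, hd, hdb⟩ := IsLocalization.integerNormalization_spec (nonZeroDivisors R) b
  refine ⟨c * d, mul_ne_zero (nonZeroDivisors.ne_zero hc) (nonZeroDivisors.ne_zero hd),
    Polynomial.C d * IsLocalization.integerNormalization (nonZeroDivisors R) a,
    Polynomial.C c * IsLocalization.integerNormalization (nonZeroDivisors R) b, ?_⟩
  apply Polynomial.map_injective (algebraMap R K) (IsFractionRing.injective R K)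
  have e1 : ∀ (x : R) (y : Polynomial K), x • y = Polynomial.C (algebraMap R K x) * y := by
    intro x y
    rw [← Polynomial.smul_eq_C_mul, algebraMap_smul]
  rw [e1] at hca hdb
  simp only [Polynomial.map_add, Polynomial.map_mul, Polynomial.map_C, hca, hdb, map_mul]
  linear_combination (-Polynomial.C (algebraMap R K c) * Polynomial.C (algebraMap R K d)) * hab

lemma aux_main {R : Type*} [CommRing R] [IsDomain R] [UniqueFactorizationMonoid R]
    (hR : ∀ z p : R, z ≠ 0 → Prime p → ∃ q, Prime q ∧ ¬ q ∣ z)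
    (P : Ideal (Polynomial R)) [hP : P.IsPrime]
    (u v : Polynomial R) (hu : Prime u) (hv : Prime v) (huv : ¬ Associated u v)
    (huP : u ∈ P) (hvP : v ∈ P) : ∃ w ∈ P ^ 2, Irreducible w := by
  obtain ⟨r, hr, a, b, hab⟩ := aux_bezout u v hu hv huv
  have hrP : Polynomial.C r ∈ P := by
    rw [hab]; exact P.add_mem (P.mul_mem_left _ huP) (P.mul_mem_left _ hvP)
  obtain ⟨p, hpP, hp, -⟩ := aux_factor (P.comap Polynomial.C) r hr hrP
  have hpP : Polynomial.C p ∈ P := hpP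
  have hCp : Prime (Polynomial.C p) := Polynomial.prime_C_iff.2 hp
  have h1 : ∃ v ∈ P, ¬ Polynomial.C p ∣ v := by
    by_contra! hcon
    exact huv ((hCp.associated_of_dvd hu (hcon u huP)).symm.trans
      (hCp.associated_of_dvd hv (hcon v hvP)))
  have h2 : ∃ v ∈ P, ¬ Polynomial.C p ∣ v ∧ v.coeff 0 ≠ 0 := by
    obtain ⟨v, hv, hpv⟩ := h1
    by_cases h0 : v.coeff 0 = 0
    · refine ⟨v + Polynomial.C p, P.add_mem hv hpP, ?_, ?_⟩
      · rwa [dvd_add_left dvd_rfl]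
      · simp [h0, hp.ne_zero]
    · exact ⟨v, hv, hpv, h0⟩
  clear huv hu hv huP hvP hab
  obtain ⟨t, htP, hpt, ht0⟩ := h2
  obtain ⟨q, hq, hqz⟩ := hR (p * t.coeff 0) p (mul_ne_zero hp.ne_zero ht0) hp
  have hqp : ¬ q ∣ p := fun h => hqz (h.mul_right _)
  have hqt : ¬ q ∣ t.coeff 0 := fun h => hqz (h.mul_left _)
  set s := Polynomial.C q * t ^ 2 with hs
  set N := s.natDegree + 1 with hN
  have hlt : s.natDegree < N := by omega
  have hp2 : p ^ 2 ≠ 0 := pow_ne_zero _ hp.ne_zero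
  have hmain : (Polynomial.C (p^2) * Polynomial.X ^ N).natDegree = N :=
    Polynomial.natDegree_C_mul_X_pow N _ hp2
  have hdeg : (Polynomial.C (p^2) * Polynomial.X ^ N + s).natDegree = N := by
    rw [Polynomial.natDegree_add_eq_left_of_natDegree_lt (by omega), hmain]
  have hcN : (Polynomial.C (p^2) * Polynomial.X ^ N + s).coeff N = p ^ 2 := by
    rw [Polynomial.coeff_add, Polynomial.coeff_eq_zero_of_natDegree_lt hlt,
      Polynomial.coeff_C_mul_X_pow, if_pos rfl, add_zero]
  have hcn : ∀ n, n ≠ N → (Polynomial.C (p^2) * Polynomial.X ^ N + s).coeff n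
      = q * (t ^ 2).coeff n := by
    intro n hn
    rw [Polynomial.coeff_add, Polynomial.coeff_C_mul_X_pow, if_neg hn, hs,
      Polynomial.coeff_C_mul, zero_add]
  refine ⟨Polynomial.C (p^2) * Polynomial.X ^ N + s, ?_, ?_⟩
  · refine Ideal.add_mem _ (Ideal.mul_mem_right _ _ ?_)
      (Ideal.mul_mem_left _ _ (Ideal.pow_mem_pow htP 2))
    rw [Polynomial.C_pow]
    exact Ideal.pow_mem_pow hpP 2
  have hqI : (Ideal.span {q}).IsPrime := (Ideal.span_singleton_prime hq.ne_zero).2 hq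
  refine Polynomial.irreducible_of_eisenstein_criterion hqI ?_ ?_ ?_ ?_ ?_
  · rw [Polynomial.leadingCoeff, hdeg, hcN, Ideal.mem_span_singleton]
    exact fun h => hqp (hq.dvd_of_dvd_pow h)
  · intro n hn
    have : n < N := by
      rw [← hdeg]
      exact Polynomial.coe_lt_degree.1 hn
    rw [hcn n this.ne, Ideal.mem_span_singleton]
    exact dvd_mul_right _ _
  · rw [← Polynomial.natDegree_pos_iff_degree_pos, hdeg]; omega
  · rw [hcn 0 (by omega), Ideal.span_singleton_pow, Ideal.mem_span_singleton, pow_two,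
      mul_dvd_mul_iff_left hq.ne_zero, Polynomial.coeff_zero_eq_eval_zero, Polynomial.eval_pow,
      ← Polynomial.coeff_zero_eq_eval_zero]
    exact fun h => hqt (hq.dvd_of_dvd_pow h)
  · intro c hc
    by_contra hcu
    have hc2 : c ∣ p ^ 2 := by
      rw [← hcN]; exact (Polynomial.C_dvd_iff_dvd_coeff _ _).1 hc N
    have hpc : p ∣ c := by
      have hc0 : c ≠ 0 := by rintro rfl; exact hp2 (zero_dvd_iff.1 hc2)
      obtain ⟨e, he, hec⟩ := WfDvdMonoid.exists_irreducible_factor hcu hc0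
      have he' := he.prime
      have := he'.dvd_of_dvd_pow (hec.trans hc2)
      exact (he'.associated_of_dvd hp this).symm.dvd.trans hec
    have hd : Polynomial.C p ∣ Polynomial.C (p^2) * Polynomial.X ^ N + s :=
      (Polynomial.C_dvd_iff_dvd_coeff _ _).2 fun i =>
        hpc.trans ((Polynomial.C_dvd_iff_dvd_coeff _ _).1 hc i)
    have hds : Polynomial.C p ∣ s := by
      rwa [dvd_add_right] at hd
      rw [pow_two, Polynomial.C_mul, mul_assoc]
      exact dvd_mul_right _ _
    rcases hCp.dvd_or_dvd hds with h | h
    · rw [Polynomial.C_dvd_iff_dvd_coeff] at h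
      have := h 0
      rw [Polynomial.coeff_C_zero] at this
      exact hqp (hp.associated_of_dvd hq this).symm.dvd
    · exact hpt (hCp.dvd_of_dvd_pow h)

lemma aux_R {k : Type*} [Field k] {σ : Type*} (z p : MvPolynomial σ k) (hz : z ≠ 0)
    (hp : Prime p) : ∃ q, Prime q ∧ ¬ q ∣ z := by
  have key : ∀ c : k, p * z ≠ C c := by
    intro c hc
    by_cases h0 : c = 0
    · subst h0
      exact mul_ne_zero hp.ne_zero hz (by simpa using hc)
    · exact hp.not_isUnit (isUnit_of_dvd_unit ⟨z, hc.symm⟩ ((isUnit_iff_ne_zero.2 h0).map C))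
  have h1 : p * z + 1 ≠ 0 := fun h => key (-1) (by
    rw [eq_neg_of_add_eq_zero_left h]; simp)
  have h2 : ¬ IsUnit (p * z + 1) := by
    intro h
    rw [MvPolynomial.isUnit_iff_eq_C_of_isReduced] at h
    obtain ⟨c, -, hc⟩ := h
    exact key (c - 1) (by rw [C_sub, ← hc]; simp)
  obtain ⟨q, hq, hqd⟩ := WfDvdMonoid.exists_irreducible_factor h2 h1
  refine ⟨q, hq.prime, fun h => hq.not_isUnit ?_⟩
  rw [dvd_add_right (h.mul_left p)] at hqd
  exact isUnit_of_dvd_one hqd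

/-- If `g² ∣ w(f₁,…,f_m)` for some square-free `w ∈ k[x₁,…,x_m]`, then
`g² ∣ w₁(f₁,…,f_m)` for some irreducible `w₁ ∈ k[x₁,…,x_m]`. -/
theorem statement2 {k : Type*} [Field k] [CharZero k] {m n : ℕ}
    (hm : 1 ≤ m) (hmn : m ≤ n)
    (f : Fin m → MvPolynomial (Fin n) k)
    (g : MvPolynomial (Fin n) k) (hg : Irreducible g)
    (h : ∃ w : MvPolynomial (Fin m) k, Squarefree w ∧ g ^ 2 ∣ aeval f w) :
    ∃ w₁ : MvPolynomial (Fin m) k, Irreducible w₁ ∧ g ^ 2 ∣ aeval f w₁ := by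
  obtain ⟨w, hw, hgw⟩ := h
  have hgp : Prime g := hg.prime
  have hQ : (Ideal.span {g}).IsPrime := (Ideal.span_singleton_prime hgp.ne_zero).2 hgp
  let P : Ideal (MvPolynomial (Fin m) k) := (Ideal.span {g}).comap (aeval f)
  have hP : P.IsPrime := Ideal.comap_isPrime _ _
  have memP : ∀ x, x ∈ P ↔ g ∣ aeval f x := fun x => by
    rw [Ideal.mem_comap, Ideal.mem_span_singleton]
  have memP2 : ∀ x ∈ P ^ 2, g ^ 2 ∣ aeval f x := by
    intro x hx
    rw [← Ideal.mem_span_singleton, ← Ideal.span_singleton_pow]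
    exact Ideal.le_comap_pow (aeval f) 2 hx
  obtain ⟨u, huP, hu, w', rfl⟩ := aux_factor P w hw.ne_zero
    ((memP w).2 ((dvd_pow_self g two_ne_zero).trans hgw))
  by_cases hgu : g ^ 2 ∣ aeval f u
  · exact ⟨u, hu.irreducible, hgu⟩
  have hw'P : w' ∈ P := by
    rw [memP] at huP ⊢
    obtain ⟨a, ha⟩ := huP
    rw [map_mul, ha, pow_two, mul_assoc, mul_dvd_mul_iff_left hgp.ne_zero] at hgw
    rcases hgp.dvd_or_dvd hgw with h | h
    · exact absurd (by rw [ha, pow_two]; exact mul_dvd_mul_left g h) hgu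
    · exact h
  obtain ⟨v, hvP, hv, hvw⟩ := aux_factor P w' (right_ne_zero_of_mul hw.ne_zero) hw'P
  have huv : ¬ Associated u v := fun h =>
    hu.not_isUnit (hw u (mul_dvd_mul_left u (h.dvd.trans hvw)))
  obtain ⟨m, rfl⟩ : ∃ l, m = l + 1 := ⟨m - 1, by omega⟩
  let e := finSuccEquiv k m
  have hP' : (P.comap e.symm).IsPrime := Ideal.comap_isPrime _ _
  obtain ⟨x, hx, hxi⟩ := aux_main aux_R (P.comap e.symm) (e u) (e v)
    ((MulEquiv.prime_iff e).2 hu) ((MulEquiv.prime_iff e).2 hv)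
    (fun h => huv (by simpa using h.map e.symm))
    (by simpa [Ideal.mem_comap] using huP) (by simpa [Ideal.mem_comap] using hvP)
  exact ⟨e.symm x, (MulEquiv.irreducible_iff e.symm).2 hxi,
    memP2 _ (Ideal.le_comap_pow e.symm 2 hx)⟩
end

section
/- Let A = k[x_1,…,x_n], where k is a field of characteristic zero, and let f_1,…,f_m ∈ A be algebraically independent over k, with 1 ≤ m ≤ n. Put R = k[f_1,…,f_m] (the k-subalgebra of A generated by f_1,…,f_m). Then the following conditions are equivalent: (i) dgcd(f_1,…,f_m) is a nonzero element of k; (ii) every irreducible element of R is square-free in A; (iii) every square-free element of R is square-free in A. -/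
open MvPolynomial

lemma chainRule {k S M σ : Type*} [Field k] [CommRing S] [Algebra k S] [AddCommGroup M] [Module S M]
    [Module k M] [Fintype σ] (D : Derivation k S M) (f : σ → S)
    (W : MvPolynomial σ k) : D (aeval f W) = ∑ l, aeval f (pderiv l W) • D (f l) := by
  classical
  induction W using MvPolynomial.induction_on with
  | C a => simp
  | add p q hp hq => simp [hp, hq, add_smul, Finset.sum_add_distrib]
  | mul_X p i hp =>
    simp only [map_mul, aeval_X, Derivation.leibniz, hp, map_add, add_smul,
      Finset.sum_add_distrib, pderiv_X, Finset.smul_sum, smul_smul]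
    rw [add_comm]
    rw [add_comm]
    congr 1
    rotate_left
    · refine Finset.sum_congr rfl fun l _ => ?_
      rw [smul_eq_mul, map_mul, aeval_X, mul_comm]
    · rw [Finset.sum_eq_single i]
      · simp
      · intro b _ hb
        simp [hb.symm]
      · simp

lemma pd_exists {k σ : Type*} [Field k] [CharZero k] (V : MvPolynomial σ k)
    (hV : ∀ c, V ≠ C c) : ∃ j, pderiv j V ≠ 0 ∧ (pderiv j V).totalDegree < V.totalDegree := by
  classical
  have h1 : ∃ s ∈ V.support, s ≠ 0 := by
    by_contra! h
    refine hV (coeff 0 V) ?_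
    ext s
    rw [coeff_C]
    split_ifs with hs
    · rw [hs]
    · by_contra h2
      exact hs (h s (mem_support_iff.2 h2)).symm
  obtain ⟨s, hs, hs0⟩ := h1
  obtain ⟨j, hj⟩ := Finsupp.ne_iff.1 hs0
  have hsj : s j ≠ 0 := by simpa using hj
  have hle : Finsupp.single j 1 ≤ s := by
    rw [Finsupp.single_le_iff]; omega
  have hdeg : ∀ t ∈ (pderiv j V).support, (t.sum fun _ e => e) + 1 ≤ V.totalDegree := by
    intro t ht
    rw [mem_support_iff, coeff_pderiv] at ht
    have : t + Finsupp.single j 1 ∈ V.support := by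
      rw [mem_support_iff]; intro h; simp [h] at ht
    have := le_totalDegree this
    rw [Finsupp.sum_add_index' (by simp) (by simp)] at this
    simpa using this
  have hne : s - Finsupp.single j 1 ∈ (pderiv j V).support := by
    rw [mem_support_iff, coeff_pderiv, tsub_add_cancel_of_le hle]
    refine mul_ne_zero (mem_support_iff.1 hs) ?_
    exact Nat.cast_add_one_ne_zero _
  refine ⟨j, fun h => by simp [h] at hne, ?_⟩
  have := hdeg _ hne
  rw [totalDegree, Finset.sup_lt_iff (by simp only [bot_eq_zero]; omega)]
  intro t ht
  exact Nat.lt_of_succ_le (hdeg t ht)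

lemma prime_exists {k σ : Type*} [Field k] [CharZero k] (P : Ideal (MvPolynomial σ k))
    [hP : P.IsPrime] (h0 : P ≠ ⊥) : ∃ V ∈ P, Irreducible V ∧ ∃ j, pderiv j V ∉ P := by
  classical
  have hex : ∃ d, ∃ V ∈ P, V ≠ 0 ∧ V.totalDegree = d := by
    obtain ⟨V, hV, hV0⟩ := Submodule.exists_mem_ne_zero_of_ne_bot h0
    exact ⟨_, V, hV, hV0, rfl⟩
  obtain ⟨V, hV, hV0, hd⟩ := Nat.find_spec hex
  have hmin : ∀ F ∈ P, F ≠ 0 → V.totalDegree ≤ F.totalDegree := fun F hF hF0 => by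
    rw [hd]; exact Nat.find_min' hex ⟨F, hF, hF0, rfl⟩
  have hconst : ∀ c : k, C c ∈ P → c = 0 := by
    intro c hc
    by_contra hc0
    apply hP.ne_top
    exact Ideal.eq_top_of_isUnit_mem _ hc ((Ne.isUnit hc0).map C)
  have hunit : ∀ a b : MvPolynomial σ k, V = a * b → a ∈ P → IsUnit b := by
    intro a b hab ha
    have ha0 : a ≠ 0 := by rintro rfl; simp at hab; exact hV0 hab
    have hb0 : b ≠ 0 := by rintro rfl; simp at hab; exact hV0 hab
    have := hmin a ha ha0
    rw [hab, totalDegree_mul_of_isDomain ha0 hb0] at this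
    have hb : b.totalDegree = 0 := by omega
    rw [totalDegree_eq_zero_iff_eq_C] at hb
    rw [hb] at hb0 ⊢
    refine (Ne.isUnit fun h => hb0 ?_).map C
    rw [h, map_zero]
  refine ⟨V, hV, ⟨fun hu => hP.ne_top (Ideal.eq_top_of_isUnit_mem _ hV hu), ?_⟩, ?_⟩
  · intro a b hab
    rcases hP.mem_or_mem (hab ▸ hV) with h | h
    · exact Or.inr (hunit a b hab h)
    · exact Or.inl (hunit b a (by rw [hab, mul_comm]) h)
  · obtain ⟨j, hj, hlt⟩ := pd_exists V (by
      rintro c rfl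
      exact hV0 (by rw [hconst c hV, map_zero]))
    exact ⟨j, fun h => absurd (hmin _ h hj) (by omega)⟩

lemma elim_coprime {B : Type*} [CommRing B] [IsDomain B] [UniqueFactorizationMonoid B]
    (V F : Polynomial B) (hV : Irreducible V) (hd : V.natDegree ≠ 0) (hF : ¬ V ∣ F) :
    ∃ b : B, b ≠ 0 ∧ Polynomial.C b ∈ Ideal.span {V, F} := by
  classical
  let := Classical.arbitrary (NormalizedGCDMonoid B)
  have hp : V.IsPrimitive := hV.isPrimitive hd
  set K := FractionRing B
  have hVK : Irreducible (V.map (algebraMap B K)) :=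
    (hp.irreducible_iff_irreducible_map_fraction_map).1 hV
  obtain ⟨p, q, -, -, h⟩ := Polynomial.exists_mul_add_mul_eq_C_resultant V F le_rfl le_rfl (Or.inl hd)
  refine ⟨V.resultant F, ?_, ?_⟩
  · intro h0
    have h1 : Polynomial.resultant (V.map (algebraMap B K)) (F.map (algebraMap B K)) = 0 := by
      rw [Polynomial.natDegree_map_eq_of_injective (IsFractionRing.injective B K),
        Polynomial.natDegree_map_eq_of_injective (IsFractionRing.injective B K),
        Polynomial.resultant_map_map, h0, map_zero]
    rw [Polynomial.resultant_eq_zero_iff] at h1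
    apply h1.2
    rw [hVK.coprime_iff_not_dvd]
    intro h2
    exact hF (hp.dvd_of_fraction_map_dvd_fraction_map h2)
  · rw [← h]
    exact Ideal.add_mem _ (Ideal.mul_mem_right _ _ (Ideal.subset_span (by simp)))
      (Ideal.mul_mem_right _ _ (Ideal.subset_span (by simp)))


lemma derivExt_basis {k L ι : Type*} [Field k] [Field L] [Algebra k L] [CharZero k]
    (v : ι → L) (hv : IsTranscendenceBasis k v) (a : ι → L) :
    ∃ d : Derivation k L L, ∀ i, d (v i) = a i := by
  let S := MvPolynomial ι k
  let alg : Algebra S L := (aeval v : S →ₐ[k] L).toAlgebra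
  have hmap : ∀ s : S, algebraMap S L s = aeval v s := fun _ => rfl
  have : IsScalarTower k S L := IsScalarTower.of_algebraMap_eq' (aeval v : S →ₐ[k] L).comp_algebraMap.symm
  have hinj : Function.Injective (algebraMap S L) := hv.1
  have : FaithfulSMul S L := (faithfulSMul_iff_algebraMap_injective S L).2 hinj
  have hS : Algebra.IsAlgebraic S L := by
    have h1 := hv.isAlgebraic
    constructor
    intro x
    obtain ⟨p, hp, hpx⟩ := h1.isAlgebraic x
    refine ⟨p.map (hv.1.aevalEquiv.symm : _ →+* S), ?_, ?_⟩
    · rw [Ne, Polynomial.map_eq_zero_iff]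
      · exact hp
      · exact hv.1.aevalEquiv.symm.injective
    · rw [Polynomial.aeval_def, Polynomial.eval₂_map]
      rw [Polynomial.aeval_def] at hpx
      convert hpx using 2
      ext y
      simp only [RingHom.comp_apply, hmap]
      have := hv.1.algebraMap_aevalEquiv (hv.1.aevalEquiv.symm y)
      rw [AlgEquiv.apply_symm_apply] at this
      exact this.symm
  let F := FractionRing S
  let : Algebra F L := FractionRing.liftAlgebra S L
  have : IsScalarTower S F L := FractionRing.isScalarTower_liftAlgebra S L
  have hF : Algebra.IsAlgebraic F L := (IsFractionRing.comap_isAlgebraic_iff (A := S) (K := F)).1 hS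
  have : CharZero F := by
    have : CharZero S := charZero_of_injective_algebraMap (algebraMap k S).injective
    exact charZero_of_injective_algebraMap (IsFractionRing.injective S F)
  have e1 : Algebra.FormallyEtale F L := Algebra.FormallyEtale.of_isSeparable F L
  have e2 : Algebra.FormallyEtale S F := Algebra.FormallyEtale.of_isLocalization (nonZeroDivisors S)
  have e3 : Algebra.FormallyEtale S L := Algebra.FormallyEtale.comp S F L
  let D0 : Derivation k S L := mkDerivation k a
  let φ := (D0.liftKaehlerDifferential.liftBaseChange L).comp
    (KaehlerDifferential.tensorKaehlerEquivOfFormallyEtale k S L).symm.toLinearMap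
  refine ⟨φ.compDer (KaehlerDifferential.D k L), fun i => ?_⟩
  have h : v i = algebraMap S L (X i) := by simp [hmap]
  rw [h]
  simp [φ, KaehlerDifferential.tensorKaehlerEquivOfFormallyEtale_symm_D_algebraMap, D0]
  exact mkDerivation_X k a i

lemma derivExt {k L ι : Type*} [Field k] [Field L] [Algebra k L] [CharZero k]
    (v : ι → L) (hv : AlgebraicIndependent k v) (a : ι → L) :
    ∃ d : Derivation k L L, ∀ i, d (v i) = a i := by
  classical
  obtain ⟨t, ht, htb⟩ := exists_isTranscendenceBasis_superset (AlgebraicIndependent.to_subtype_range hv)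
  obtain ⟨d, hd⟩ := derivExt_basis _ htb (fun x => if h : ∃ i, v i = x then a h.choose else 0)
  refine ⟨d, fun i => ?_⟩
  have := hd ⟨v i, ht ⟨i, rfl⟩⟩
  rw [this]
  have h : ∃ j, v j = v i := ⟨i, rfl⟩
  rw [dif_pos h, (AlgebraicIndependent.injective hv) h.choose_spec]

noncomputable def splitVar (k : Type*) [Field k] {σ : Type*} [DecidableEq σ] (j : σ) :
    MvPolynomial σ k ≃ₐ[k] Polynomial (MvPolynomial {i : σ // i ≠ j} k) :=
  (renameEquiv k (Equiv.optionSubtypeNe j).symm).trans (optionEquivLeft k _)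

lemma splitVar_rename {k σ : Type*} [Field k] [DecidableEq σ] (j : σ)
    (b : MvPolynomial {i : σ // i ≠ j} k) :
    splitVar k j (rename Subtype.val b) = Polynomial.C b := by
  induction b using MvPolynomial.induction_on with
  | C a => simp [splitVar]
  | add p q hp hq => simp [hp, hq]
  | mul_X p i hp =>
    rw [map_mul, map_mul, hp, map_mul]
    congr 1
    simp [splitVar, Equiv.optionSubtypeNe_symm_of_ne i.2]

lemma splitVar_natDegree {k σ : Type*} [Field k] [DecidableEq σ] (j : σ)
    (V : MvPolynomial σ k) (h : pderiv j V ≠ 0) : (splitVar k j V).natDegree ≠ 0 := by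
  intro h0
  obtain ⟨b, hb⟩ := Polynomial.natDegree_eq_zero.1 h0
  rw [← splitVar_rename] at hb
  have := (splitVar k j).injective hb
  apply h
  rw [← this]
  apply pderiv_eq_zero_of_notMem_vars
  intro hj
  have := vars_rename _ _ hj
  simp at this

lemma dichotomy {k σ : Type*} [Field k] [CharZero k] (P : Ideal (MvPolynomial σ k))
    [hP : P.IsPrime] (h0 : P ≠ ⊥) : ∃ V ∈ P, Irreducible V ∧ ∃ j, pderiv j V ∉ P ∧
      ((∀ F ∈ P, V ∣ F) ∨ ∃ G : MvPolynomial {i : σ // i ≠ j} k, Irreducible G ∧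
        rename Subtype.val G ∈ P ∧ ∃ i, rename Subtype.val (pderiv i G) ∉ P) := by
  classical
  obtain ⟨V, hV, hVi, j, hj⟩ := prime_exists P h0
  refine ⟨V, hV, hVi, j, hj, ?_⟩
  by_cases hdv : ∀ F ∈ P, V ∣ F
  · exact Or.inl hdv
  right
  push Not at hdv
  obtain ⟨F, hF, hVF⟩ := hdv
  have hd := splitVar_natDegree j V (by rintro h; rw [h] at hj; simp at hj)
  obtain ⟨b, hb0, hb⟩ := elim_coprime (splitVar k j V) (splitVar k j F)
    ((MulEquiv.irreducible_iff (splitVar k j)).2 hVi) hd (by rwa [map_dvd_iff])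
  let Q : Ideal (MvPolynomial {i : σ // i ≠ j} k) :=
    P.comap (rename Subtype.val : MvPolynomial {i : σ // i ≠ j} k →ₐ[k] _)
  have hbQ : b ∈ Q := by
    have h1 : Ideal.span {splitVar k j V, splitVar k j F} ≤
        P.comap ((splitVar k j).symm : _ →ₐ[k] MvPolynomial σ k) := by
      rw [Ideal.span_le]
      rintro x (rfl | rfl)
      · simpa using hV
      · simpa using hF
    have h2 := h1 hb
    rw [← splitVar_rename] at h2
    change rename Subtype.val b ∈ P
    simpa using h2
  have hQ : Q ≠ ⊥ := by
    intro h; rw [h] at hbQ; exact hb0 (by simpa using hbQ)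
  have : Q.IsPrime := Ideal.comap_isPrime _ _
  obtain ⟨G, hG, hGi, i, hi⟩ := prime_exists Q hQ
  exact ⟨G, hGi, hG, i, hi⟩

lemma exists_prime_not_dvd {k τ : Type*} [Field k] (G b : MvPolynomial τ k)
    (hG : Irreducible G) (hb : b ≠ 0) : ∃ π, Prime π ∧ ¬ π ∣ G * b := by
  have h0 : G * b + 1 ≠ 0 := by
    intro h
    apply hG.not_isUnit
    exact isUnit_of_mul_isUnit_left (y := b) (by rw [eq_neg_of_add_eq_zero_left h]; simp)
  have hu : ¬ IsUnit (G * b + 1) := by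
    intro hu
    obtain ⟨c, hc, hcc⟩ := (MvPolynomial.isUnit_iff_eq_C_of_isReduced).1 hu
    have h1 : G * b = C (c - 1) := by rw [map_sub, ← hcc]; simp
    by_cases hc1 : c - 1 = 0
    · rw [hc1, map_zero] at h1
      exact (mul_ne_zero hG.ne_zero hb) h1
    · apply hG.not_isUnit
      exact isUnit_of_mul_isUnit_left (y := b) (by rw [h1]; exact (Ne.isUnit hc1).map C)
  obtain ⟨π, hπ, hd⟩ := WfDvdMonoid.exists_irreducible_factor hu h0
  refine ⟨π, hπ.prime, fun h => hπ.not_isUnit ?_⟩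
  rw [dvd_add_right h] at hd
  exact isUnit_of_dvd_one hd

lemma eisenstein_constr {B : Type*} [CommRing B] [IsDomain B] [UniqueFactorizationMonoid B]
    (G π : B) (V : Polynomial B) (hG : Irreducible G) (hV : ¬ Polynomial.C G ∣ V)
    (hπ : Prime π) (h : ¬ π ∣ G * V.coeff 0) :
    ∃ w : Polynomial B, Irreducible w ∧ w ∈ (Ideal.span {Polynomial.C G, V}) ^ 2 := by
  have hπG : ¬ π ∣ G := fun h' => h (h'.mul_right _)
  have hπV : ¬ π ∣ V.coeff 0 := fun h' => h (h'.mul_left _)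
  set N := 2 * V.natDegree + 1 with hN
  set w : Polynomial B := Polynomial.C (G ^ 2) * Polynomial.X ^ N + Polynomial.C π * V ^ 2 with hw
  have hG2 : G ^ 2 ≠ 0 := pow_ne_zero _ hG.ne_zero
  have hd1 : (Polynomial.C (G ^ 2) * Polynomial.X ^ N).natDegree = N :=
    Polynomial.natDegree_C_mul_X_pow _ _ hG2
  have hd2 : (Polynomial.C π * V ^ 2).natDegree < N := by
    refine (Polynomial.natDegree_C_mul_le _ _).trans_lt ?_
    rw [Polynomial.natDegree_pow]; omega
  have hdeg : w.natDegree = N := by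
    rw [hw, Polynomial.natDegree_add_eq_left_of_natDegree_lt (by rw [hd1]; exact hd2), hd1]
  have hcN : w.coeff N = G ^ 2 := by
    rw [hw, Polynomial.coeff_add, Polynomial.coeff_eq_zero_of_natDegree_lt hd2,
      Polynomial.coeff_C_mul, Polynomial.coeff_X_pow]
    simp
  have hc : ∀ n, n ≠ N → w.coeff n = π * (V ^ 2).coeff n := by
    intro n hn
    rw [hw, Polynomial.coeff_add, Polynomial.coeff_C_mul, Polynomial.coeff_X_pow,
      Polynomial.coeff_C_mul, if_neg hn]
    simp
  have hw0 : w ≠ 0 := by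
    intro h0; rw [h0] at hcN; simp at hcN; exact hG2 hcN.symm
  have hprim : w.IsPrimitive := by
    intro r hr
    by_contra hru
    have hr0 : r ≠ 0 := by
      rintro rfl
      simp at hr; exact hw0 hr
    obtain ⟨p, hp, hpr⟩ := WfDvdMonoid.exists_irreducible_factor hru hr0
    have hpw : Polynomial.C p ∣ w := (map_dvd Polynomial.C hpr).trans hr
    have hpG : p ∣ G := by
      have := (Polynomial.C_dvd_iff_dvd_coeff _ _).1 hpw N
      rw [hcN] at this
      exact hp.prime.dvd_of_dvd_pow this
    have hass : Associated p G := hp.associated_of_dvd hG hpG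
    have h1 : Polynomial.C p ∣ Polynomial.C π * V ^ 2 := by
      rw [hw] at hpw
      refine (dvd_add_right ?_).1 hpw
      exact Dvd.dvd.mul_right (map_dvd Polynomial.C (hpG.trans (dvd_pow_self _ two_ne_zero))) _
    have hCp : Prime (Polynomial.C p) := Polynomial.prime_C_iff.2 hp.prime
    rcases hCp.dvd_or_dvd h1 with h2 | h2
    · have h3 : p ∣ π := by
        have := (Polynomial.C_dvd_iff_dvd_coeff _ _).1 h2 0
        simpa using this
      have := hp.associated_of_dvd hπ.irreducible h3
      exact hπG (this.symm.dvd.trans hpG)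
    · have h3 := hCp.dvd_of_dvd_pow h2
      exact hV ((map_dvd Polynomial.C hass.symm.dvd).trans h3)
  refine ⟨w, ?_, ?_⟩
  · refine Polynomial.irreducible_of_eisenstein_criterion (P := Ideal.span {π})
      ((Ideal.span_singleton_prime hπ.ne_zero).2 hπ) ?_ ?_ ?_ ?_ hprim
    · rw [Polynomial.leadingCoeff, hdeg, hcN, Ideal.mem_span_singleton]
      exact fun h' => hπG (hπ.dvd_of_dvd_pow h')
    · intro n hn
      rw [Polynomial.degree_eq_natDegree hw0, hdeg] at hn
      have hn' : n < N := by exact_mod_cast hn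
      rw [hc n hn'.ne, Ideal.mem_span_singleton]
      exact dvd_mul_right _ _
    · rw [← Polynomial.natDegree_pos_iff_degree_pos, hdeg]; omega
    · rw [hc 0 (by omega), Ideal.span_singleton_pow, Ideal.mem_span_singleton, sq,
        mul_dvd_mul_iff_left hπ.ne_zero, Polynomial.coeff_zero_eq_eval_zero, Polynomial.eval_pow,
        ← Polynomial.coeff_zero_eq_eval_zero]
      exact fun h' => hπV (hπ.dvd_of_dvd_pow h')
  · have hA : Polynomial.C G ∈ Ideal.span {Polynomial.C G, V} := Ideal.subset_span (by simp)
    have hB : V ∈ Ideal.span {Polynomial.C G, V} := Ideal.subset_span (by simp)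
    rw [hw, map_pow]
    exact Ideal.add_mem _ (Ideal.mul_mem_right _ _ (Ideal.pow_mem_pow hA 2))
      (Ideal.mul_mem_left _ _ (Ideal.pow_mem_pow hB 2))

lemma exists_irred_sq {k σ : Type*} [Field k] (P : Ideal (MvPolynomial σ k))
    (V : MvPolynomial σ k) (hVP : V ∈ P) (hV : Irreducible V) (j : σ) (hj : pderiv j V ≠ 0)
    (G : MvPolynomial {i : σ // i ≠ j} k) (hG : Irreducible G) (hGP : rename Subtype.val G ∈ P) :
    ∃ w ∈ P ^ 2, Irreducible w := by
  classical
  set V1 := splitVar k j V with hV1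
  have hdeg := splitVar_natDegree j V hj
  have hV1i : Irreducible V1 := (MulEquiv.irreducible_iff (splitVar k j)).2 hV
  have hGV : ¬ Polynomial.C G ∣ V1 := by
    intro h
    have hCG : Irreducible (Polynomial.C G) := (Polynomial.prime_C_iff.2 hG.prime).irreducible
    have := hCG.associated_of_dvd hV1i h
    have := Polynomial.natDegree_eq_of_degree_eq (Polynomial.degree_eq_degree_of_associated this)
    rw [Polynomial.natDegree_C] at this
    exact hdeg this.symm
  obtain ⟨V2, hV2P, hV2, hV20⟩ : ∃ V2, (splitVar k j).symm V2 ∈ P ∧ ¬ Polynomial.C G ∣ V2 ∧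
      V2.coeff 0 ≠ 0 := by
    by_cases h : V1.coeff 0 = 0
    · refine ⟨V1 + Polynomial.C G, ?_, ?_, ?_⟩
      · rw [map_add, ← splitVar_rename, hV1]
        simpa using Ideal.add_mem _ hVP hGP
      · rwa [dvd_add_self_right]
      · simp [h, hG.ne_zero]
    · exact ⟨V1, by simpa [hV1] using hVP, hGV, h⟩
  obtain ⟨π, hπ, hd⟩ := exists_prime_not_dvd G _ hG hV20
  obtain ⟨w, hw, hwm⟩ := eisenstein_constr G π V2 hG hV2 hπ hd
  refine ⟨(splitVar k j).symm w, ?_, (MulEquiv.irreducible_iff (splitVar k j).symm).2 hw⟩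
  have h1 : Ideal.span {Polynomial.C G, V2} ≤
        P.comap ((splitVar k j).symm : _ →ₐ[k] MvPolynomial σ k) := by
    rw [Ideal.span_le]
    rintro x (rfl | rfl)
    · rw [← splitVar_rename]; simpa using hGP
    · simpa using hV2P
  exact Ideal.le_comap_pow _ 2 (Ideal.pow_right_mono h1 2 hwm)

lemma rows_dep {L : Type*} [Field L] {m n : ℕ} (M : Matrix (Fin m) (Fin n) L)
    (h : ∀ i : Fin m → Fin n, StrictMono i → (Matrix.of fun j l => M j (i l)).det = 0) :
    ∃ c : Fin m → L, c ≠ 0 ∧ ∀ i, ∑ l, c l * M l i = 0 := by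
  classical
  by_contra! hcon
  have hrow : LinearIndependent L M.row := by
    rw [Fintype.linearIndependent_iff]
    intro c hc
    by_contra! hne
    obtain ⟨i, hi⟩ := hcon c (by rintro rfl; obtain ⟨i, hi⟩ := hne; simp at hi)
    apply hi
    have := congrFun hc i
    simpa [Finset.sum_apply] using this
  have hrank : M.rank = m := by simpa using hrow.rank_matrix
  rw [Matrix.rank_eq_finrank_span_cols] at hrank
  obtain ⟨κ, a, ha, hspan, hli⟩ := exists_linearIndependent' L M.col
  have : Fintype κ := @Fintype.ofFinite κ (Finite.of_injective a ha)
  have hcard : Fintype.card κ = m := by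
    rw [← hrank, ← hspan, finrank_span_eq_card hli]
  let S : Finset (Fin n) := Finset.univ.image a
  have hS : S.card = m := by
    rw [Finset.card_image_of_injective _ ha, Finset.card_univ, hcard]
  let i := S.orderEmbOfFin hS
  apply absurd (h i i.strictMono)
  have hmem : ∀ l, ∃ x, a x = i l := by
    intro l
    have := S.orderEmbOfFin_mem hS l
    obtain ⟨x, -, hx⟩ := Finset.mem_image.1 this
    exact ⟨x, hx⟩
  choose b hb using hmem
  have hbinj : Function.Injective b := by
    intro x y hxy
    apply i.injective
    rw [← hb, ← hb, hxy]
  have hli2 := hli.comp b hbinj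
  have hcol : LinearIndependent L (Matrix.of fun j l => M j (i l)).col := by
    have he : (Matrix.of fun j l => M j (i l)).col = (M.col ∘ a) ∘ b := by
      ext l j
      change M j (i l) = M j (a (b l))
      rw [hb]
    rw [he]
    exact hli2
  rw [Matrix.linearIndependent_cols_iff_isUnit, Matrix.isUnit_iff_isUnit_det] at hcol
  exact hcol.ne_zero

lemma kernel_dvd {k : Type*} [Field k] {m n : ℕ} (f : Fin m → MvPolynomial (Fin n) k)
    (g : MvPolynomial (Fin n) k) (hg : Irreducible g) (c : Fin m → MvPolynomial (Fin n) k)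
    (j : Fin m) (hj : ¬ g ∣ c j) (hk : ∀ i, g ∣ ∑ l, c l * pderiv i (f l))
    (i : Fin m → Fin n) : g ∣ jacDet f i := by
  set M : Matrix (Fin m) (Fin m) (MvPolynomial (Fin n) k) :=
    Matrix.of fun j l => pderiv (i l) (f j) with hM
  have h1 : Matrix.vecMul (Matrix.vecMul c M) M.adjugate = M.det • c := by
    rw [Matrix.vecMul_vecMul, Matrix.mul_adjugate, Matrix.vecMul_smul, Matrix.vecMul_one]
  have h2 : g ∣ M.det * c j := by
    have := congrFun h1 j
    rw [Pi.smul_apply, smul_eq_mul] at this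
    rw [← this]
    change g ∣ ∑ l, (∑ t, c t * pderiv (i l) (f t)) * M.adjugate l j
    refine Finset.dvd_sum fun l _ => ?_
    exact Dvd.dvd.mul_right (hk (i l)) _
  exact (hg.prime.dvd_or_dvd h2).resolve_right hj

lemma forward {k : Type*} [Field k] [CharZero k] {m n : ℕ} (f : Fin m → MvPolynomial (Fin n) k)
    (g : MvPolynomial (Fin n) k) (hg : Irreducible g) (W : MvPolynomial (Fin m) k)
    (hW : Squarefree W) (hgW : g ^ 2 ∣ aeval f W) (i : Fin m → Fin n) : g ∣ jacDet f i := by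
  classical
  have hgp := hg.prime
  have : (Ideal.span {g}).IsPrime := (Ideal.span_singleton_prime hg.ne_zero).2 hgp
  let P : Ideal (MvPolynomial (Fin m) k) :=
    (Ideal.span {g}).comap (aeval f : MvPolynomial (Fin m) k →ₐ[k] _)
  have hPm : ∀ F : MvPolynomial (Fin m) k, F ∈ P ↔ g ∣ aeval f F := fun F => by
    rw [Ideal.mem_comap, Ideal.mem_span_singleton]
  have hPp : P.IsPrime := Ideal.comap_isPrime _ _
  have hWP : W ∈ P := (hPm W).2 ((dvd_pow_self g two_ne_zero).trans hgW)
  have hP0 : P ≠ ⊥ := by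
    intro h
    rw [h] at hWP
    exact hW.ne_zero (by simpa using hWP)
  have hch : ∀ (F : MvPolynomial (Fin m) k) i,
      pderiv i (aeval f F) = ∑ l, aeval f (pderiv l F) * pderiv i (f l) := fun F i => by
    rw [chainRule]; rfl
  obtain ⟨V, hVP, hVi, j, hj, hcase⟩ := dichotomy P hP0
  rw [hPm] at hj hVP
  -- case g^2 | V(f)
  have caseV : g ^ 2 ∣ aeval f V → g ∣ jacDet f i := by
    rintro ⟨u, hu⟩
    refine kernel_dvd f g hg (fun l => aeval f (pderiv l V)) j hj (fun i => ?_) i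
    rw [← hch, hu, sq, mul_assoc, pderiv_mul, pderiv_mul]
    exact dvd_add (Dvd.dvd.mul_left (dvd_mul_right _ _) _) (dvd_mul_right _ _)
  rcases hcase with hpr | ⟨G, hGi, hGP, s, hs⟩
  · obtain ⟨U, hU⟩ := hpr W hWP
    apply caseV
    have hUg : ¬ g ∣ aeval f U := by
      intro h
      obtain ⟨U', hU'⟩ := hpr U ((hPm U).2 h)
      exact hVi.not_isUnit (hW V ⟨U', by rw [hU, hU', mul_assoc]⟩)
    rw [hU, map_mul] at hgW
    exact hgp.pow_dvd_of_dvd_mul_right 2 hUg hgW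
  · rw [hPm] at hGP hs
    by_cases h2 : g ^ 2 ∣ aeval f V
    · exact caseV h2
    obtain ⟨h, hh⟩ := hVP
    obtain ⟨h', hh'⟩ := hGP
    have hgh : ¬ g ∣ h := by
      rintro ⟨u, rfl⟩
      exact h2 ⟨u, by rw [hh]; ring⟩
    set G' : MvPolynomial (Fin m) k := rename Subtype.val G with hG'
    have hGj : pderiv j G' = 0 := by
      apply pderiv_eq_zero_of_notMem_vars
      intro hj
      have := vars_rename _ _ hj
      simp at this
    have hGs : pderiv s.1 G' = rename Subtype.val (pderiv s G) :=
      pderiv_rename Subtype.val_injective _ _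
    set c : Fin m → MvPolynomial (Fin n) k := fun l =>
      h' * aeval f (pderiv l V) - h * aeval f (pderiv l G') with hc
    have hker : ∀ i, g ∣ ∑ l, c l * pderiv i (f l) := by
      intro i
      have : ∑ l, c l * pderiv i (f l) = h' * pderiv i (aeval f V) - h * pderiv i (aeval f G') := by
        rw [hch, hch, Finset.mul_sum, Finset.mul_sum, ← Finset.sum_sub_distrib]
        refine Finset.sum_congr rfl fun l _ => ?_
        rw [hc]; ring
      rw [this, hh, hh', pderiv_mul, pderiv_mul]
      exact ⟨h' * pderiv i h - h * pderiv i h', by ring⟩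
    by_cases hh2 : g ∣ h'
    · refine kernel_dvd f g hg c s.1 ?_ hker i
      rw [hc]
      intro hd
      rw [dvd_sub_right (hh2.mul_right _), hGs] at hd
      exact (hgp.dvd_or_dvd hd).elim hgh hs
    · refine kernel_dvd f g hg c j ?_ hker i
      rw [hc]
      intro hd
      simp only [hGj, map_zero, mul_zero, sub_zero] at hd
      exact (hgp.dvd_or_dvd hd).elim hh2 hj

lemma key_rel {k L : Type*} [Field k] [Field L] [Algebra k L] {m n : ℕ}
    (f : Fin m → MvPolynomial (Fin n) k) (q : MvPolynomial (Fin n) k →ₐ[k] L)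
    (c : Fin m → L) (hc : ∀ i, ∑ l, c l * q (pderiv i (f l)) = 0) (d : Derivation k L L) :
    ∑ l, c l * d (q (f l)) = 0 := by
  have hq : aeval (fun i => q (X i)) = q := (aeval_unique q).symm
  have h1 : ∀ F, d (q F) = ∑ i, q (pderiv i F) * d (q (X i)) := by
    intro F
    have := chainRule d (fun i => q (X i)) F
    rw [hq] at this
    simpa using this
  have h2 : ∑ l, c l * d (q (f l)) = ∑ l, ∑ i, c l * (q (pderiv i (f l)) * d (q (X i))) :=
    Finset.sum_congr rfl fun l _ => by rw [h1, Finset.mul_sum]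
  rw [h2, Finset.sum_comm]
  refine Finset.sum_eq_zero fun i _ => ?_
  simp_rw [← mul_assoc, ← Finset.sum_mul]
  rw [hc, zero_mul]

lemma backward_aux {k L : Type*} [Field k] [CharZero k] [Field L] [Algebra k L] {m n : ℕ}
    (f : Fin m → MvPolynomial (Fin n) k)
    (g : MvPolynomial (Fin n) k) (hg : Irreducible g)
    (q : MvPolynomial (Fin n) k →ₐ[k] L) (hq : ∀ x, q x = 0 ↔ g ∣ x)
    (hJ : ∀ i : Fin m → Fin n, StrictMono i → g ∣ jacDet f i) :
    ∃ w : MvPolynomial (Fin m) k, Irreducible w ∧ g ^ 2 ∣ aeval f w := by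
  classical
  have hgp := hg.prime
  have : (Ideal.span {g}).IsPrime := (Ideal.span_singleton_prime hg.ne_zero).2 hgp
  let P : Ideal (MvPolynomial (Fin m) k) :=
    (Ideal.span {g}).comap (aeval f : MvPolynomial (Fin m) k →ₐ[k] _)
  have hPm : ∀ F : MvPolynomial (Fin m) k, F ∈ P ↔ g ∣ aeval f F := fun F => by
    rw [Ideal.mem_comap, Ideal.mem_span_singleton]
  have hPp : P.IsPrime := Ideal.comap_isPrime _ _
  have hch : ∀ (F : MvPolynomial (Fin m) k) i,
      pderiv i (aeval f F) = ∑ l, aeval f (pderiv l F) * pderiv i (f l) := fun F i => by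
    rw [chainRule]; rfl
  have hqf : ∀ F : MvPolynomial (Fin m) k, aeval (fun l => q (f l)) F = q (aeval f F) := by
    intro F
    rw [← AlgHom.comp_apply, comp_aeval]
  -- the relation
  obtain ⟨c, hc0, hc⟩ := rows_dep (fun l i => q (pderiv i (f l))) (by
    intro i hi
    have h1 := (hq _).2 (hJ i hi)
    rw [jacDet] at h1
    have h2 := RingHom.map_det (q : MvPolynomial (Fin n) k →+* L)
      (Matrix.of fun j l => pderiv (i l) (f j))
    rw [RingHom.coe_coe, h1] at h2
    exact h2.symm)
  by_cases hP0 : P = ⊥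
  · exfalso
    have hind : AlgebraicIndependent k (fun l => q (f l)) := by
      rw [algebraicIndependent_iff]
      intro F hF
      rw [hqf, hq, ← hPm, hP0] at hF
      simpa using hF
    apply hc0
    funext l0
    obtain ⟨d, hd⟩ := derivExt _ hind (Pi.single l0 1)
    have := key_rel f q c hc d
    simp_rw [hd] at this
    simpa [Pi.single_apply] using this
  obtain ⟨V, hVP, hVi, j, hj, hcase⟩ := dichotomy P hP0
  rcases hcase with hpr | ⟨G, hGi, hGP, -⟩
  swap
  · obtain ⟨w, hw, hwi⟩ := exists_irred_sq P V hVP hVi j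
      (by intro h; rw [h] at hj; simp at hj) G hGi hGP
    refine ⟨w, hwi, ?_⟩
    have := Ideal.le_comap_pow (aeval f : MvPolynomial (Fin m) k →ₐ[k] _) 2 hw
    rwa [Ideal.mem_comap, Ideal.span_singleton_pow, Ideal.mem_span_singleton] at this
  refine ⟨V, hVi, ?_⟩
  have hdeg := splitVar_natDegree j V (by intro h; rw [h] at hj; simp at hj)
  have hind : AlgebraicIndependent k (fun l : {i // i ≠ j} => q (f l)) := by
    rw [algebraicIndependent_iff]
    intro b hb
    have h1 : rename Subtype.val b ∈ P := by
      rw [hPm, ← hq, ← hqf, aeval_rename]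
      exact hb
    have h2 := map_dvd (splitVar k j) (hpr _ h1)
    rw [splitVar_rename] at h2
    by_contra hb0
    have h3 := Polynomial.natDegree_le_of_dvd h2 (by simpa using hb0)
    rw [Polynomial.natDegree_C] at h3
    omega
  have hVj : q (aeval f (pderiv j V)) ≠ 0 := by
    rw [Ne, hq, ← hPm]; exact hj
  set v : Fin m → L := fun l => q (aeval f (pderiv l V)) with hv
  have hprop : ∀ l, v j * c l = c j * v l := by
    intro l0
    by_cases hl : l0 = j
    · rw [hl, mul_comm]
    obtain ⟨d, hd⟩ := derivExt _ hind (Pi.single ⟨l0, hl⟩ 1)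
    have e1 := key_rel f q c hc d
    have e2 : ∑ l, v l * d (q (f l)) = 0 := by
      have := chainRule d (fun l => q (f l)) V
      rw [hqf, (hq _).2 ((hPm V).1 hVP), map_zero] at this
      simp_rw [hqf] at this
      exact this.symm
    have hsum : ∀ u : Fin m → L, ∑ l, u l * d (q (f l)) = u l0 + u j * d (q (f j)) := by
      intro u
      rw [← Finset.sum_subset (Finset.subset_univ {l0, j}), Finset.sum_pair hl]
      · have := hd ⟨l0, hl⟩
        simp at this
        rw [this, mul_one]
      · intro x _ hx
        have hxj : x ≠ j := fun h => hx (by simp [h])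
        have hxl : x ≠ l0 := fun h => hx (by simp [h])
        have := hd ⟨x, hxj⟩
        rw [Pi.single_eq_of_ne (by simpa using hxl)] at this
        simp only at this
        rw [this, mul_zero]
    rw [hsum] at e1 e2
    linear_combination v j * e1 - c j * e2
  have hcj : c j ≠ 0 := by
    intro h
    apply hc0
    funext l
    have := hprop l
    rw [h, zero_mul] at this
    exact (mul_eq_zero.1 this).resolve_left hVj
  have hzero : ∀ i, q (pderiv i (aeval f V)) = 0 := by
    intro i
    rw [hch, map_sum]
    have h1 : c j * ∑ l, v l * q (pderiv i (f l)) = 0 := by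
      rw [Finset.mul_sum]
      simp_rw [← mul_assoc, ← hprop, mul_assoc, ← Finset.mul_sum]
      rw [hc, mul_zero]
    have h2 := (mul_eq_zero.1 h1).resolve_left hcj
    rw [← h2]
    exact Finset.sum_congr rfl fun l _ => by rw [map_mul]
  obtain ⟨h, hh⟩ := (hPm V).1 hVP
  obtain ⟨i, hi0, hi⟩ := pd_exists g (by
    rintro a rfl
    by_cases ha : a = 0
    · exact hg.ne_zero (by simp [ha])
    · exact hg.not_isUnit ((Ne.isUnit ha).map C))
  have h1 := (hq _).1 (hzero i)
  rw [hh, pderiv_mul, dvd_add_left (dvd_mul_right _ _)] at h1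
  rcases hgp.dvd_or_dvd h1 with h2 | h2
  · exfalso
    obtain ⟨u, hu⟩ := h2
    have hu0 : u ≠ 0 := by rintro rfl; simp at hu; exact hi0 hu
    rw [hu, totalDegree_mul_of_isDomain hg.ne_zero hu0] at hi
    omega
  · obtain ⟨u, rfl⟩ := h2
    exact ⟨u, by rw [hh]; ring⟩

lemma backward {k : Type*} [Field k] [CharZero k] {m n : ℕ}
    (f : Fin m → MvPolynomial (Fin n) k)
    (g : MvPolynomial (Fin n) k) (hg : Irreducible g)
    (hJ : ∀ i : Fin m → Fin n, StrictMono i → g ∣ jacDet f i) :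
    ∃ w : MvPolynomial (Fin m) k, Irreducible w ∧ g ^ 2 ∣ aeval f w := by
  have : (Ideal.span {g}).IsPrime := (Ideal.span_singleton_prime hg.ne_zero).2 hg.prime
  let A := MvPolynomial (Fin n) k
  let Q := A ⧸ Ideal.span {g}
  let q : A →ₐ[k] FractionRing Q :=
    (IsScalarTower.toAlgHom k Q (FractionRing Q)).comp (Ideal.Quotient.mkₐ k (Ideal.span {g}))
  refine backward_aux f g hg q (fun x => ?_) hJ
  change algebraMap Q (FractionRing Q) (Ideal.Quotient.mk (Ideal.span {g}) x) = 0 ↔ _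
  rw [FaithfulSMul.algebraMap_eq_zero_iff, Ideal.Quotient.eq_zero_iff_mem,
    Ideal.mem_span_singleton]


/-- Theorem 2: for algebraically independent `f₁,…,f_m ∈ k[x₁,…,xₙ]` and
`R = k[f₁,…,f_m]`, the following are equivalent:
(i) `dgcd(f₁,…,f_m) ∈ k ∖ {0}` (i.e. some nonzero constant is a dgcd of the `fᵢ`);
(ii) every irreducible element of `R` is square-free in `k[x₁,…,xₙ]`;
(iii) every square-free element of `R` is square-free in `k[x₁,…,xₙ]`. -/
theorem statement4 {k : Type*} [Field k] [CharZero k] {m n : ℕ}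
    (hm : 1 ≤ m) (hmn : m ≤ n)
    (f : Fin m → MvPolynomial (Fin n) k)
    (hf : AlgebraicIndependent k f) :
    List.TFAE
      [∃ c : k, c ≠ 0 ∧ IsDgcd f (C c),
       ∀ r : Algebra.adjoin k (Set.range f), Irreducible r →
         Squarefree (r : MvPolynomial (Fin n) k),
       ∀ r : Algebra.adjoin k (Set.range f), Squarefree r →
         Squarefree (r : MvPolynomial (Fin n) k)] := by
  have hcoe : ∀ W : MvPolynomial (Fin m) k, ((hf.aevalEquiv W : Algebra.adjoin k (Set.range f)) :
      MvPolynomial (Fin n) k) = aeval f W := fun W => hf.algebraMap_aevalEquiv W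
  tfae_have 1 → 3 := by
    rintro ⟨c, hc, hd⟩ r hr
    obtain ⟨W, rfl⟩ := hf.aevalEquiv.surjective r
    have hW : Squarefree W := by
      rintro a ⟨b, hb⟩
      have := hr (hf.aevalEquiv a) ⟨hf.aevalEquiv b, by rw [hb, map_mul, map_mul]⟩
      exact (MulEquiv.isUnit_map hf.aevalEquiv).1 this
    rw [hcoe]
    have h0 : aeval f W ≠ 0 := by
      intro h
      exact hW.ne_zero ((algebraicIndependent_iff.1 hf) W h)
    intro a ha
    by_contra hau
    have ha0 : a ≠ 0 := by
      rintro rfl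
      rw [zero_mul, zero_dvd_iff] at ha
      exact h0 ha
    obtain ⟨g, hg, hga⟩ := WfDvdMonoid.exists_irreducible_factor hau ha0
    have hgW : g ^ 2 ∣ aeval f W := by
      rw [sq]; exact (mul_dvd_mul hga hga).trans ha
    have := hd.2 g fun i _ => forward f g hg W hW hgW i
    exact hg.not_isUnit (isUnit_of_dvd_unit this ((Ne.isUnit hc).map C))
  tfae_have 3 → 2 := fun h r hr => h r hr.squarefree
  tfae_have 2 → 1 := by
    intro h
    have hno : ∀ g : MvPolynomial (Fin n) k, Irreducible g →
        ¬ ∀ i : Fin m → Fin n, StrictMono i → g ∣ jacDet f i := by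
      intro g hg hJ
      obtain ⟨w, hw, hgw⟩ := backward f g hg hJ
      have := h (hf.aevalEquiv w) ((MulEquiv.irreducible_iff hf.aevalEquiv).2 hw)
      rw [hcoe] at this
      exact hg.not_isUnit (this g (by rwa [← sq]))
    refine ⟨1, one_ne_zero, fun i _ => by simp, fun e he => ?_⟩
    by_contra heu
    have heu' : ¬ IsUnit e := fun hu => heu hu.dvd
    by_cases he0 : e = 0
    · have hX : Irreducible (X ⟨0, by omega⟩ : MvPolynomial (Fin n) k) :=
        (MvPolynomial.X_prime).irreducible
      exact hno _ hX fun i hi => (he0 ▸ dvd_zero _ : _ ∣ e).trans (he i hi)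
    · obtain ⟨g, hg, hge⟩ := WfDvdMonoid.exists_irreducible_factor heu' he0
      exact hno g hg fun i hi => hge.trans (he i hi)
  tfae_finish
end
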